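/- arXiv:2412.15136 — 9 statements merged into one kernel-verified Lean document; each statement's English description precedes it below -/
import Mathlib

section
/- For every integer q, the Hessian matrix of U at the q-twisted state u^{(q)} equals −2πK·cos(2πq/n)·L; consequently its characteristic polynomial is ∏_{k=0}^{n−1} (x − 8πK·cos(2πq/n)·sin²(πk/n)), i.e., its eigenvalues with multiplicity are λ_k = 8πK·cos(2πq/n)·sin²(πk/n) for k = 0,…,n−1. -/
/-- Cyclic successor on `Fin n`. -/
def fsucc {n : ℕ} (i : Fin n) : Fin n := ⟨((i : ℕ) + 1) % n, Nat.mod_lt _ i.pos⟩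

/-- The nearest-neighbor Kuramoto potential on `ℝ^n`. -/
noncomputable def Unn (n : ℕ) (K : ℝ) (u : Fin n → ℝ) : ℝ :=
  -(K / (2 * Real.pi)) * ∑ i : Fin n, Real.cos (2 * Real.pi * (u (fsucc i) - u i))

/-- The Hessian matrix of `U` at `u`, with entries `∂²U/∂u_i∂u_j (u)`. -/
noncomputable def hessU (n : ℕ) (K : ℝ) (u : Fin n → ℝ) : Matrix (Fin n) (Fin n) ℝ :=
  Matrix.of fun i j =>
    iteratedFDeriv ℝ 2 (Unn n K) u ![Pi.single i 1, Pi.single j 1]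

/-- The `q`-twisted state `u^{(q)}_i = q·i/n`. -/
noncomputable def twist (n : ℕ) (q : ℤ) : Fin n → ℝ := fun i => (q : ℝ) * (i : ℕ) / n

/-- The `n×n` periodic discrete Laplacian: `L_{ii} = −2`, `L_{ij} = 1` if
`i − j ≡ ±1 (mod n)`, and `0` otherwise. -/
def Lmat (n : ℕ) : Matrix (Fin n) (Fin n) ℝ :=
  Matrix.of fun i j =>
    if i = j then -2
    else if ((i : ℕ) : ZMod n) - ((j : ℕ) : ZMod n) = 1 ∨
            ((i : ℕ) : ZMod n) - ((j : ℕ) : ZMod n) = -1 then 1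
    else 0

open Matrix in
/-- If `A * P = P * diagonal d` with `P` invertible, then `d` lists the eigenvalues of `A`. -/
theorem Matrix.charpoly_eq_prod_of_mul_eq_mul_diagonal {ι R : Type*} [Fintype ι] [DecidableEq ι]
    [CommRing R] {A P : Matrix ι ι R} {d : ι → R} (hP : IsUnit P.det)
    (h : A * P = P * diagonal d) :
    A.charpoly = ∏ k, (Polynomial.X - Polynomial.C (d k)) := by
  obtain ⟨u, rfl⟩ := (Matrix.isUnit_iff_isUnit_det P).mpr hP
  have hA : A = u.val * diagonal d * u⁻¹.val := by
    rw [← h, mul_assoc, Units.mul_inv, mul_one]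
  rw [hA, coe_units_inv, Matrix.charpoly_units_conj, Matrix.charpoly_diagonal]

/-- Second derivative of a trigonometric sum `c * ∑ cos (a * ℓ k x)` along linear forms `ℓ k`. -/
theorem iteratedFDeriv_two_mul_sum_cos {E ι : Type*} [NormedAddCommGroup E] [NormedSpace ℝ E]
    [Fintype ι] (c a : ℝ) (l : ι → E →L[ℝ] ℝ) (x : E) (m : Fin 2 → E) :
    iteratedFDeriv ℝ 2 (fun y => c * ∑ k, Real.cos (a * l k y)) x m =
      -(c * a ^ 2) * ∑ k, Real.cos (a * l k x) * (l k (m 0) * l k (m 1)) := by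
  have h1 (y : E) : HasFDerivAt (fun y => c * ∑ k, Real.cos (a * l k y))
      (c • ∑ k, -Real.sin (a * l k y) • a • l k) y :=
    (HasFDerivAt.fun_sum fun k _ => (((l k).hasFDerivAt (x := y)).const_mul a).cos).const_mul c
  have h2 : HasFDerivAt (fun y => c • ∑ k, -Real.sin (a * l k y) • a • l k)
      (c • ∑ k, (-(Real.cos (a * l k x) • a • l k)).smulRight (a • l k)) x :=
    (HasFDerivAt.fun_sum fun k _ =>
      (((l k).hasFDerivAt (x := x)).const_mul a).sin.neg.smul_const (a • l k)).const_smul c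
  rw [iteratedFDeriv_two_apply, funext fun y => (h1 y).fderiv, h2.fderiv]
  simp only [smul_apply, sum_apply,
    ContinuousLinearMap.smulRight_apply, neg_apply, smul_eq_mul,
    Finset.mul_sum]
  exact Finset.sum_congr rfl fun k _ => by ring

theorem fsucc_eq_add_one {m : ℕ} (i : Fin (m + 3)) : fsucc i = i + 1 := by
  ext
  simp [fsucc, Fin.val_add]

theorem cos_twist_fsucc_sub (m : ℕ) (q : ℤ) (i : Fin (m + 3)) :
    Real.cos (2 * Real.pi * (twist (m + 3) q (fsucc i) - twist (m + 3) q i)) =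
      Real.cos (2 * Real.pi * (q : ℝ) / (m + 3 : ℕ)) := by
  have hn : ((m + 3 : ℕ) : ℝ) ≠ 0 := by positivity
  rcases Nat.lt_or_ge ((i : ℕ) + 1) (m + 3) with h | h
  · simp only [twist, fsucc, Nat.mod_eq_of_lt h]
    congr 1
    field_simp
    push_cast
    ring
  · have hi : (i : ℕ) + 1 = m + 3 := le_antisymm i.isLt h
    have hr : ((i : ℕ) : ℝ) = (m + 3 : ℕ) - 1 := eq_sub_of_add_eq (mod_cast hi)
    simp only [twist, fsucc, hi, Nat.mod_self, hr]
    rw [← Real.cos_sub_int_mul_two_pi (2 * Real.pi * (q : ℝ) / (m + 3 : ℕ)) q]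
    congr 1
    field_simp
    push_cast
    ring

theorem Lmat_apply (m : ℕ) (i j : Fin (m + 3)) :
    Lmat (m + 3) i j =
      (if i + 1 = j then 1 else 0) + (if j + 1 = i then 1 else 0) -
        2 * (if i = j then 1 else 0) := by
  have hc (k : Fin (m + 3)) : (((k : ℕ) : ZMod (m + 3)) : Fin (m + 3)) = k :=
    Fin.cast_val_eq_self k
  have h1 : ((i : ℕ) : ZMod (m + 3)) - ((j : ℕ) : ZMod (m + 3)) = 1 ↔ j + 1 = i := by
    rw [sub_eq_iff_eq_add', eq_comm]
    change (((j : ℕ) : ZMod (m + 3)) : Fin (m + 3)) + 1 = ((i : ℕ) : ZMod (m + 3)) ↔ _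
    rw [hc, hc]
    rfl
  have h2 : ((i : ℕ) : ZMod (m + 3)) - ((j : ℕ) : ZMod (m + 3)) = -1 ↔ i + 1 = j := by
    rw [sub_eq_iff_eq_add', ← sub_eq_add_neg, eq_sub_iff_add_eq]
    change (((i : ℕ) : ZMod (m + 3)) : Fin (m + 3)) + 1 = ((j : ℕ) : ZMod (m + 3)) ↔ _
    rw [hc, hc]
    rfl
  have h4 : i + 1 + 1 ≠ i := by
    rw [add_assoc, Ne, add_eq_left, Fin.ext_iff]
    simp [Fin.val_add, Nat.mod_eq_of_lt]
  simp only [Lmat, Matrix.of_apply, h1, h2]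
  by_cases hij : i = j
  · subst hij; simp
  · by_cases ha : i + 1 = j
    · subst ha; simp [h4]
    · simp [hij, ha]

theorem sum_edge_mul_edge (m : ℕ) (i j : Fin (m + 3)) :
    ∑ k : Fin (m + 3),
      ((Pi.single i 1 : Fin (m + 3) → ℝ) (fsucc k) - (Pi.single i 1 : Fin (m + 3) → ℝ) k) *
      ((Pi.single j 1 : Fin (m + 3) → ℝ) (fsucc k) - (Pi.single j 1 : Fin (m + 3) → ℝ) k) =
      -Lmat (m + 3) i j := by
  have hs (f g : Fin (m + 3) → ℝ) : ∑ k, f (fsucc k) * g (fsucc k) = ∑ k, f k * g k := by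
    simp only [fsucc_eq_add_one]
    exact Equiv.sum_comp (Equiv.addRight (1 : Fin (m + 3))) fun k => f k * g k
  simp only [sub_mul, mul_sub, Finset.sum_sub_distrib, hs, Lmat_apply]
  simp only [Pi.single_apply, fsucc_eq_add_one, mul_ite, mul_one, mul_zero,
    ← eq_sub_iff_add_eq, Finset.sum_ite_eq', Finset.mem_univ, if_true]
  simp only [eq_comm (a := j) (b := i), eq_comm (a := j - 1) (b := i)]
  split_ifs <;> ring

theorem hessU_twist (m : ℕ) (K : ℝ) (q : ℤ) :
    hessU (m + 3) K (twist (m + 3) q) =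
      (-(2 * Real.pi * K * Real.cos (2 * Real.pi * (q : ℝ) / (m + 3 : ℕ)))) • Lmat (m + 3) := by
  ext i j
  have h := iteratedFDeriv_two_mul_sum_cos (-(K / (2 * Real.pi))) (2 * Real.pi)
    (fun k : Fin (m + 3) => ContinuousLinearMap.proj (R := ℝ) (φ := fun _ => ℝ) (fsucc k) -
      ContinuousLinearMap.proj (R := ℝ) (φ := fun _ => ℝ) k) (twist (m + 3) q)
    ![Pi.single i 1, Pi.single j 1]
  simp only [sub_apply, ContinuousLinearMap.proj_apply, Matrix.cons_val_zero,
    Matrix.cons_val_one, cos_twist_fsucc_sub] at h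
  rw [← Finset.mul_sum, sum_edge_mul_edge] at h
  rw [Matrix.smul_apply, smul_eq_mul]
  refine h.trans ?_
  have := Real.pi_ne_zero
  field_simp

theorem two_sub_exp_sub_exp_neg (z : ℂ) :
    2 - Complex.exp (2 * z * Complex.I) - Complex.exp (-(2 * z * Complex.I)) =
      4 * Complex.sin z ^ 2 := by
  have h := Complex.two_cos (2 * z)
  have hdouble := Complex.cos_two_mul' z
  have hone := Complex.sin_sq_add_cos_sq z
  rw [neg_mul] at h
  linear_combination h - 2 * hdouble - 2 * hone

/-- The discrete Fourier modes diagonalize the periodic Laplacian. -/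
theorem Lmat_mul_vandermonde (m : ℕ) {ζ : ℂ} (hζ : ζ ^ (m + 3) = 1) :
    (Lmat (m + 3)).map Complex.ofReal *
        Matrix.vandermonde (fun i : Fin (m + 3) => ζ ^ (i : ℕ)) =
      Matrix.vandermonde (fun i : Fin (m + 3) => ζ ^ (i : ℕ)) *
        Matrix.diagonal fun k : Fin (m + 3) => ζ ^ (k : ℕ) + (ζ ^ (k : ℕ))⁻¹ - 2 := by
  have hζ0 : ζ ≠ 0 := by rintro rfl; simp at hζ
  have hsucc (i : Fin (m + 3)) : ζ ^ ((i + 1 : Fin (m + 3)) : ℕ) = ζ ^ (i : ℕ) * ζ := by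
    rw [← fsucc_eq_add_one, ← pow_succ, fsucc, ← pow_mod_orderOf, Nat.mod_mod_of_dvd _
      (orderOf_dvd_of_pow_eq_one hζ), pow_mod_orderOf]
  have hpred (i : Fin (m + 3)) : ζ ^ ((i - 1 : Fin (m + 3)) : ℕ) = ζ ^ (i : ℕ) * ζ⁻¹ := by
    rw [eq_mul_inv_iff_mul_eq₀ hζ0, ← hsucc, sub_add_cancel]
  ext i k
  rw [Matrix.mul_diagonal, Matrix.mul_apply]
  simp only [Matrix.map_apply, Lmat_apply, Matrix.vandermonde_apply, ← eq_sub_iff_add_eq (b := i)]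
  simp only [Complex.ofReal_sub, Complex.ofReal_add, Complex.ofReal_mul, apply_ite Complex.ofReal,
    Complex.ofReal_one, Complex.ofReal_zero, Complex.ofReal_ofNat, sub_mul, add_mul, mul_assoc,
    Finset.sum_sub_distrib, Finset.sum_add_distrib, ← Finset.mul_sum, ite_mul, one_mul, zero_mul,
    Finset.sum_ite_eq', Finset.sum_ite_eq, Finset.mem_univ, if_true, hsucc, hpred, mul_pow, inv_pow]
  ring

theorem charpoly_smul_Lmat (m : ℕ) (c : ℝ) :
    ((-c) • Lmat (m + 3)).charpoly =
      ∏ k : Fin (m + 3), (Polynomial.X - Polynomial.C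
        (c * (4 * Real.sin (Real.pi * (k : ℕ) / (m + 3 : ℕ)) ^ 2))) := by
  apply Polynomial.map_injective Complex.ofRealHom Complex.ofReal_injective
  have hζ := Complex.isPrimitiveRoot_exp (m + 3) (by omega)
  set ζ := Complex.exp (2 * Real.pi * Complex.I / (m + 3 : ℕ)) with hζ_def
  have hdet : IsUnit (Matrix.vandermonde (fun i : Fin (m + 3) => ζ ^ (i : ℕ))).det :=
    isUnit_iff_ne_zero.mpr <| Matrix.det_vandermonde_ne_zero_iff.mpr fun i j h =>
      Fin.ext (hζ.pow_inj i.isLt j.isLt h)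
  have hd (k : Fin (m + 3)) : -(c : ℂ) * (ζ ^ (k : ℕ) + (ζ ^ (k : ℕ))⁻¹ - 2) =
      Complex.ofRealHom (c * (4 * Real.sin (Real.pi * (k : ℕ) / (m + 3 : ℕ)) ^ 2)) := by
    have h := two_sub_exp_sub_exp_neg (Real.pi * (k : ℕ) / (m + 3 : ℕ))
    have he : ζ ^ (k : ℕ) =
        Complex.exp (2 * (Real.pi * (k : ℕ) / (m + 3 : ℕ)) * Complex.I) := by
      rw [hζ_def, ← Complex.exp_nat_mul]
      congr 1
      ring
    rw [Complex.exp_neg, ← he] at h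
    simp only [Complex.ofRealHom_eq_coe, Complex.ofReal_mul, Complex.ofReal_pow,
      Complex.ofReal_sin, Complex.ofReal_div, Complex.ofReal_natCast, Complex.ofReal_ofNat]
    linear_combination (c : ℂ) * h
  have hmul : (((-c) • Lmat (m + 3)).map Complex.ofRealHom) *
        Matrix.vandermonde (fun i : Fin (m + 3) => ζ ^ (i : ℕ)) =
      Matrix.vandermonde (fun i : Fin (m + 3) => ζ ^ (i : ℕ)) *
        Matrix.diagonal fun k : Fin (m + 3) => -(c : ℂ) * (ζ ^ (k : ℕ) + (ζ ^ (k : ℕ))⁻¹ - 2) := by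
    have h1 : ((-c) • Lmat (m + 3)).map Complex.ofRealHom =
        (-(c : ℂ)) • (Lmat (m + 3)).map Complex.ofReal := by
      ext i j; simp
    have h2 : (Matrix.diagonal fun k : Fin (m + 3) =>
        -(c : ℂ) * (ζ ^ (k : ℕ) + (ζ ^ (k : ℕ))⁻¹ - 2)) =
        (-(c : ℂ)) • Matrix.diagonal fun k : Fin (m + 3) =>
          ζ ^ (k : ℕ) + (ζ ^ (k : ℕ))⁻¹ - 2 := by
      rw [← Matrix.diagonal_smul]; rfl
    rw [h1, h2, Matrix.smul_mul, Matrix.mul_smul, Lmat_mul_vandermonde m hζ.pow_eq_one]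
  rw [← Matrix.charpoly_map, Matrix.charpoly_eq_prod_of_mul_eq_mul_diagonal hdet hmul,
    Polynomial.map_prod]
  simp only [hd, Polynomial.map_sub, Polynomial.map_X, Polynomial.map_C]

/-- The Hessian of the Kuramoto potential at the `q`-twisted state equals
`−2πK·cos(2πq/n)·L`, and its characteristic polynomial is
`∏_{k=0}^{n−1} (x − 8πK·cos(2πq/n)·sin²(πk/n))`. -/
theorem hessian_at_twisted_state (n : ℕ) (hn : 3 ≤ n) (K : ℝ) (hK : 0 < K) (q : ℤ) :
    hessU n K (twist n q) =
      (-(2 * Real.pi * K * Real.cos (2 * Real.pi * (q : ℝ) / n))) • Lmat n ∧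
    (hessU n K (twist n q)).charpoly =
      ∏ k : Fin n, (Polynomial.X - Polynomial.C
        (8 * Real.pi * K * Real.cos (2 * Real.pi * (q : ℝ) / n) *
          Real.sin (Real.pi * (k : ℕ) / n) ^ 2)) := by
  obtain ⟨m, rfl⟩ := Nat.exists_eq_add_of_le' hn
  refine ⟨hessU_twist m K q, ?_⟩
  rw [hessU_twist, charpoly_smul_Lmat]
  refine Finset.prod_congr rfl fun k _ => ?_
  congr 2
  ring
end

section
/- Let n ≥ 5, K > 0, and let r ∈ ℤ + 1/2 be a half-integer with −n/4 + 1/2 < r < n/4 − 1/2. Then the Hessian of U at v^{(r)} has exactly one strictly negative eigenvalue (counted with multiplicity), 0 is an eigenvalue of multiplicity exactly one, and the remaining n − 2 eigenvalues are strictly positive; i.e., v^{(r)} is a saddle of Morse index 1. -/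
/-- The saddle candidate state `v^{(r)}_i = r·i/(n−2)`. -/
noncomputable def vstate (n : ℕ) (r : ℝ) : Fin n → ℝ := fun i => r * (i : ℕ) / ((n : ℝ) - 2)

open Matrix

namespace Matrix.IsHermitian

variable {ι : Type*} [Fintype ι] [DecidableEq ι] {A : Matrix ι ι ℝ}

theorem eigenvectorBasis_dotProduct (hA : A.IsHermitian) (i j : ι) :
    (hA.eigenvectorBasis i).ofLp ⬝ᵥ (hA.eigenvectorBasis j).ofLp = if i = j then 1 else 0 := by
  have h := orthonormal_iff_ite.mp hA.eigenvectorBasis.orthonormal j i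
  rw [EuclideanSpace.inner_eq_star_dotProduct] at h
  simpa [eq_comm] using h

/-- If the quadratic form of `A` is nonnegative on a hyperplane, then `A` has at most one
negative eigenvalue. -/
theorem card_eigenvalues_neg_le_one (hA : A.IsHermitian) (φ : (ι → ℝ) →ₗ[ℝ] ℝ)
    (hφ : ∀ x, φ x = 0 → 0 ≤ x ⬝ᵥ A *ᵥ x) :
    (Finset.univ.filter fun k => hA.eigenvalues k < 0).card ≤ 1 := by
  rw [Finset.card_le_one]
  intro i hi j hj
  by_contra hij
  simp only [Finset.mem_filter, Finset.mem_univ, true_and] at hi hj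
  have key (s t : ℝ) (hst : s * φ (hA.eigenvectorBasis i).ofLp
      + t * φ (hA.eigenvectorBasis j).ofLp = 0) :
      0 ≤ s ^ 2 * hA.eigenvalues i + t ^ 2 * hA.eigenvalues j := by
    have h := hφ (s • (hA.eigenvectorBasis i).ofLp + t • (hA.eigenvectorBasis j).ofLp)
      (by simpa using hst)
    simp only [mulVec_add, mulVec_smul, mulVec_eigenvectorBasis, add_dotProduct, dotProduct_add,
      smul_dotProduct, dotProduct_smul, eigenvectorBasis_dotProduct, hij, Ne.symm hij, if_true,
      if_false, smul_eq_mul] at h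
    linarith
  by_cases h : φ (hA.eigenvectorBasis i).ofLp = 0
  · have := key 1 0 (by simp [h])
    linarith
  · have := key (-φ (hA.eigenvectorBasis j).ofLp) (φ (hA.eigenvectorBasis i).ofLp) (by ring)
    have := mul_neg_of_pos_of_neg (sq_pos_of_ne_zero h) hj
    have := mul_nonpos_of_nonneg_of_nonpos (sq_nonneg (-φ (hA.eigenvectorBasis j).ofLp)) hi.le
    linarith

/-- If the kernel of `A` lies on a line, then `0` is at most a simple eigenvalue of `A`. -/
theorem card_eigenvalues_eq_zero_le_one (hA : A.IsHermitian) (v : ι → ℝ)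
    (hv : ∀ x, A *ᵥ x = 0 → ∃ c : ℝ, x = c • v) :
    (Finset.univ.filter fun k => hA.eigenvalues k = 0).card ≤ 1 := by
  rw [Finset.card_le_one]
  intro i hi j hj
  by_contra hij
  simp only [Finset.mem_filter, Finset.mem_univ, true_and] at hi hj
  obtain ⟨c, hc⟩ := hv _ (by rw [mulVec_eigenvectorBasis, hi, zero_smul] :
    A *ᵥ (hA.eigenvectorBasis i).ofLp = 0)
  obtain ⟨d, hd⟩ := hv _ (by rw [mulVec_eigenvectorBasis, hj, zero_smul] :
    A *ᵥ (hA.eigenvectorBasis j).ofLp = 0)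
  have hii := hA.eigenvectorBasis_dotProduct i i
  have hjj := hA.eigenvectorBasis_dotProduct j j
  have h0 := hA.eigenvectorBasis_dotProduct i j
  simp only [hc, hd, hij, if_true, if_false, smul_dotProduct, dotProduct_smul, smul_eq_mul]
    at hii hjj h0
  have : (c * (c * (v ⬝ᵥ v))) * (d * (d * (v ⬝ᵥ v))) = (c * (d * (v ⬝ᵥ v))) ^ 2 := by ring
  rw [hii, hjj] at this
  have h0' : c * (d * (v ⬝ᵥ v)) = 0 := by linarith
  rw [h0'] at this
  norm_num at this

theorem exists_eigenvalues_neg (hA : A.IsHermitian) {x : ι → ℝ} (hx : x ⬝ᵥ A *ᵥ x < 0) :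
    ∃ i, hA.eigenvalues i < 0 := by
  by_contra! h
  have := (hA.posSemidef_iff_eigenvalues_nonneg.mpr h).dotProduct_mulVec_nonneg x
  simp only [star_trivial] at this
  linarith

theorem exists_eigenvalues_eq_zero (hA : A.IsHermitian) {v : ι → ℝ} (hv : v ≠ 0)
    (h : A *ᵥ v = 0) : ∃ i, hA.eigenvalues i = 0 := by
  have hdet := exists_mulVec_eq_zero_iff.mp ⟨v, hv, h⟩
  rw [hA.det_eq_prod_eigenvalues, Finset.prod_eq_zero_iff] at hdet
  simpa using hdet

/-- A symmetric matrix whose kernel is a line, whose quadratic form takes a negative value and is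
nonnegative on a hyperplane, has inertia `(1, 1, card ι - 2)`. -/
theorem card_eigenvalues_of_index_one (hA : A.IsHermitian) (φ : (ι → ℝ) →ₗ[ℝ] ℝ)
    (hφ : ∀ x, φ x = 0 → 0 ≤ x ⬝ᵥ A *ᵥ x) {x v : ι → ℝ} (hx : x ⬝ᵥ A *ᵥ x < 0) (hv : v ≠ 0)
    (hAv : A *ᵥ v = 0) (hker : ∀ y, A *ᵥ y = 0 → ∃ c : ℝ, y = c • v) :
    (Finset.univ.filter fun k => hA.eigenvalues k < 0).card = 1 ∧
    (Finset.univ.filter fun k => hA.eigenvalues k = 0).card = 1 ∧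
    (Finset.univ.filter fun k => 0 < hA.eigenvalues k).card = Fintype.card ι - 2 := by
  have hneg : (Finset.univ.filter fun k => hA.eigenvalues k < 0).card = 1 := by
    refine le_antisymm (hA.card_eigenvalues_neg_le_one φ hφ) (Finset.card_pos.mpr ?_)
    obtain ⟨i, hi⟩ := hA.exists_eigenvalues_neg hx
    exact ⟨i, by simpa using hi⟩
  have hzero : (Finset.univ.filter fun k => hA.eigenvalues k = 0).card = 1 := by
    refine le_antisymm (hA.card_eigenvalues_eq_zero_le_one v hker) (Finset.card_pos.mpr ?_)
    obtain ⟨i, hi⟩ := hA.exists_eigenvalues_eq_zero hv hAv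
    exact ⟨i, by simpa using hi⟩
  refine ⟨hneg, hzero, ?_⟩
  have h₁ := Finset.card_filter_add_card_filter_not (s := Finset.univ)
    (fun k => hA.eigenvalues k < 0)
  have h₂ := Finset.card_filter_add_card_filter_not
    (s := Finset.univ.filter fun k => ¬ hA.eigenvalues k < 0) (fun k => hA.eigenvalues k = 0)
  have h₃ : (Finset.univ.filter fun k => ¬ hA.eigenvalues k < 0).filter
      (fun k => hA.eigenvalues k = 0) = Finset.univ.filter fun k => hA.eigenvalues k = 0 := by
    ext k
    simp only [Finset.mem_filter, Finset.mem_univ, true_and]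
    grind
  have h₄ : (Finset.univ.filter fun k => ¬ hA.eigenvalues k < 0).filter
      (fun k => ¬ hA.eigenvalues k = 0) = Finset.univ.filter fun k => 0 < hA.eigenvalues k := by
    ext k
    simp only [Finset.mem_filter, Finset.mem_univ, true_and]
    grind
  rw [h₃, h₄] at h₂
  rw [Finset.card_univ] at h₁
  omega

end Matrix.IsHermitian

section Hessian

variable {n : ℕ}

/-- The difference of the coordinates at the two ends of the edge from `k` to `fsucc k`. -/
noncomputable def edgeDiff (k : Fin n) : (Fin n → ℝ) →L[ℝ] ℝ :=
  ContinuousLinearMap.proj (R := ℝ) (φ := fun _ : Fin n => ℝ) (fsucc k) -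
    ContinuousLinearMap.proj (R := ℝ) (φ := fun _ : Fin n => ℝ) k

@[simp]
theorem edgeDiff_apply (k : Fin n) (u : Fin n → ℝ) : edgeDiff k u = u (fsucc k) - u k := rfl

theorem hasFDerivAt_Unn (K : ℝ) (u : Fin n → ℝ) :
    HasFDerivAt (Unn n K)
      (∑ k, (K * Real.sin (2 * Real.pi * edgeDiff k u)) • edgeDiff k) u := by
  have h := (HasFDerivAt.fun_sum fun (k : Fin n) (_ : k ∈ Finset.univ) =>
    (((edgeDiff k).hasFDerivAt (x := u)).const_mul (2 * Real.pi)).cos).const_mul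
      (-(K / (2 * Real.pi)))
  refine h.congr_fderiv ?_
  rw [Finset.smul_sum]
  refine Finset.sum_congr rfl fun k _ => ?_
  rw [smul_smul, smul_smul]
  congr 1
  field_simp

theorem hessU_apply (K : ℝ) (u : Fin n → ℝ) (i j : Fin n) :
    hessU n K u i j = ∑ k, 2 * Real.pi * K * Real.cos (2 * Real.pi * edgeDiff k u) *
      edgeDiff k (Pi.single i 1) * edgeDiff k (Pi.single j 1) := by
  have hf : fderiv ℝ (Unn n K) =
      fun u => ∑ k, (K * Real.sin (2 * Real.pi * edgeDiff k u)) • edgeDiff k :=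
    funext fun u => (hasFDerivAt_Unn K u).fderiv
  have h := HasFDerivAt.fun_sum fun (k : Fin n) (_ : k ∈ Finset.univ) =>
    (((((edgeDiff k).hasFDerivAt (x := u)).const_mul (2 * Real.pi)).sin).const_mul K).smul_const
      (edgeDiff k)
  rw [hessU, of_apply, iteratedFDeriv_two_apply, hf, h.fderiv]
  simp only [_root_.sum_apply, ContinuousLinearMap.smulRight_apply,
    _root_.smul_apply, smul_eq_mul, cons_val_zero, cons_val_one]
  exact Finset.sum_congr rfl fun k _ => by ring

theorem hessU_isHermitian (K : ℝ) (u : Fin n → ℝ) : (hessU n K u).IsHermitian := by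
  ext i j
  simp only [conjTranspose_apply, star_trivial, hessU_apply]
  exact Finset.sum_congr rfl fun k _ => by ring

theorem dotProduct_hessU_mulVec (K : ℝ) (u x y : Fin n → ℝ) :
    x ⬝ᵥ hessU n K u *ᵥ y = ∑ k, 2 * Real.pi * K * Real.cos (2 * Real.pi * edgeDiff k u) *
      edgeDiff k x * edgeDiff k y := by
  have hexp (k : Fin n) (z : Fin n → ℝ) :
      edgeDiff k z = ∑ i, z i * edgeDiff k (Pi.single i 1) := by
    conv_lhs => rw [pi_eq_sum_univ' z]
    simp [map_sum]
  simp only [dotProduct, mulVec, hessU_apply, Finset.mul_sum, Finset.sum_mul]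
  have hk (k : Fin n) : 2 * Real.pi * K * Real.cos (2 * Real.pi * edgeDiff k u) *
      edgeDiff k x * edgeDiff k y = ∑ i, ∑ j, x i * (2 * Real.pi * K *
        Real.cos (2 * Real.pi * edgeDiff k u) * edgeDiff k (Pi.single i 1) *
        edgeDiff k (Pi.single j 1) * y j) := by
    rw [hexp k x, hexp k y, mul_assoc, Finset.sum_mul_sum, Finset.mul_sum]
    refine Finset.sum_congr rfl fun i _ => ?_
    rw [Finset.mul_sum]
    exact Finset.sum_congr rfl fun j _ => by ring
  simp only [hk]
  conv_rhs => rw [Finset.sum_comm]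
  refine Finset.sum_congr rfl fun i _ => ?_
  conv_rhs => rw [Finset.sum_comm]

end Hessian

section Path

variable {m : ℕ}

theorem fsucc_castSucc (i : Fin m) : fsucc i.castSucc = i.succ := by
  ext
  simp [fsucc, Nat.mod_eq_of_lt]

theorem fsucc_last : fsucc (Fin.last m) = 0 := by
  ext
  simp [fsucc]

theorem sum_succ_sub_castSucc (x : Fin (m + 1) → ℝ) :
    ∑ i : Fin m, (x i.succ - x i.castSucc) = x (Fin.last m) - x 0 := by
  have h₁ := Fin.sum_univ_succ x
  have h₂ := Fin.sum_univ_castSucc x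
  rw [Finset.sum_sub_distrib]
  linarith

/-- The bilinear form of the cycle whose edges all have weight `1`, except for the edge joining
the last vertex to the first one, of weight `-1`. -/
noncomputable def signedCycleForm (x y : Fin (m + 1) → ℝ) : ℝ :=
  ∑ i : Fin m, (x i.succ - x i.castSucc) * (y i.succ - y i.castSucc) -
    (x 0 - x (Fin.last m)) * (y 0 - y (Fin.last m))

/-- The radical of `signedCycleForm` consists of the constant vectors. -/
theorem eq_const_of_signedCycleForm_eq_zero (hm : m ≠ 1) {y : Fin (m + 1) → ℝ}
    (h : ∀ x, signedCycleForm x y = 0) (i : Fin (m + 1)) : y i = y 0 := by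
  have hstep (k : Fin m) : y k.succ - y k.castSucc = y (Fin.last m) - y 0 := by
    have hk := h fun j => if (k : ℕ) < j then 1 else 0
    have hd (j : Fin m) : ((if (k : ℕ) < (j.succ : Fin (m + 1)) then 1 else 0) -
        (if (k : ℕ) < (j.castSucc : Fin (m + 1)) then 1 else 0) : ℝ) = if j = k then 1 else 0 := by
      simp only [Fin.val_succ, Fin.val_castSucc, Fin.ext_iff]
      grind
    simp only [signedCycleForm, hd, ite_mul, one_mul, zero_mul, Finset.sum_ite_eq',
      Finset.mem_univ, if_true, Fin.val_last, k.isLt, Fin.val_zero, Nat.not_lt_zero,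
      if_false] at hk
    linarith
  have hsum := sum_succ_sub_castSucc y
  simp only [hstep, Finset.sum_const, Finset.card_univ, Fintype.card_fin, nsmul_eq_mul] at hsum
  have hlast : y (Fin.last m) - y 0 = 0 := by
    have hm' : (m : ℝ) - 1 ≠ 0 := sub_ne_zero.mpr (by exact_mod_cast hm)
    refine (mul_eq_zero.mp ?_).resolve_left hm'
    linarith
  induction i using Fin.induction with
  | zero => rfl
  | succ k ih => linarith [hstep k]

theorem dotProduct_hessU_vstate (K : ℝ) {r : ℝ} (hr : ∃ p : ℤ, r = (p : ℝ) + 1 / 2)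
    (hm : m ≠ 1) (x y : Fin (m + 1) → ℝ) :
    x ⬝ᵥ hessU (m + 1) K (vstate (m + 1) r) *ᵥ y =
      2 * Real.pi * K * Real.cos (2 * Real.pi * (r / ((m : ℝ) - 1))) * signedCycleForm x y := by
  have hm' : (m : ℝ) - 1 ≠ 0 := sub_ne_zero.mpr (by exact_mod_cast hm)
  have hden : ((m + 1 : ℕ) : ℝ) - 2 = m - 1 := by
    push_cast
    ring
  have hpath (i : Fin m) : edgeDiff i.castSucc (vstate (m + 1) r) = r / ((m : ℝ) - 1) := by
    simp only [edgeDiff_apply, fsucc_castSucc, vstate, hden, Fin.val_succ, Fin.val_castSucc]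
    push_cast
    ring
  have hlast : Real.cos (2 * Real.pi * edgeDiff (Fin.last m) (vstate (m + 1) r)) =
      -Real.cos (2 * Real.pi * (r / ((m : ℝ) - 1))) := by
    obtain ⟨p, hp⟩ := hr
    have harg : 2 * Real.pi * edgeDiff (Fin.last m) (vstate (m + 1) r) =
        -((2 * Real.pi * (r / ((m : ℝ) - 1)) + Real.pi) + p * (2 * Real.pi)) := by
      have hsplit : edgeDiff (Fin.last m) (vstate (m + 1) r) = -(r + r / ((m : ℝ) - 1)) := by
        simp only [edgeDiff_apply, fsucc_last, vstate, hden, Fin.val_last, Fin.val_zero]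
        field_simp
        simp
      rw [hsplit, neg_add, mul_add]
      nth_rw 1 [hp]
      ring
    rw [harg, Real.cos_neg, Real.cos_add_int_mul_two_pi, Real.cos_add_pi]
  rw [dotProduct_hessU_mulVec, Fin.sum_univ_castSucc, hlast, signedCycleForm]
  simp only [hpath, edgeDiff_apply, fsucc_castSucc, fsucc_last]
  simp only [mul_assoc, ← Finset.mul_sum]
  ring

end Path

/-- For `n ≥ 5` and a half-integer `r` with `−n/4 + 1/2 < r < n/4 − 1/2`, the
Hessian of `U` at `v^{(r)}` has exactly one strictly negative eigenvalue, `0` as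
an eigenvalue of multiplicity exactly one, and `n − 2` strictly positive
eigenvalues (all counted with multiplicity): `v^{(r)}` is a saddle of Morse index 1. -/
theorem vstate_is_index_one_saddle (n : ℕ) (hn : 5 ≤ n) (K : ℝ) (hK : 0 < K)
    (r : ℝ) (hr : ∃ m : ℤ, r = (m : ℝ) + 1 / 2)
    (hr₁ : -(n : ℝ) / 4 + 1 / 2 < r) (hr₂ : r < (n : ℝ) / 4 - 1 / 2) :
    ∃ μ : Fin n → ℝ,
      (hessU n K (vstate n r)).charpoly =
        ∏ k : Fin n, (Polynomial.X - Polynomial.C (μ k)) ∧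
      (Finset.univ.filter fun k => μ k < 0).card = 1 ∧
      (Finset.univ.filter fun k => μ k = 0).card = 1 ∧
      (Finset.univ.filter fun k => 0 < μ k).card = n - 2 := by
  obtain ⟨m, rfl⟩ : ∃ m, n = m + 1 := ⟨n - 1, by omega⟩
  have hm : (4 : ℝ) ≤ m := by exact_mod_cast (by omega : 4 ≤ m)
  push_cast at hr₁ hr₂
  have hcos : 0 < Real.cos (2 * Real.pi * (r / ((m : ℝ) - 1))) := by
    have h₁ : -(1 / 4) < r / ((m : ℝ) - 1) := by
      rw [lt_div_iff₀ (by linarith)]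
      linarith
    have h₂ : r / ((m : ℝ) - 1) < 1 / 4 := by
      rw [div_lt_iff₀ (by linarith)]
      linarith
    apply Real.cos_pos_of_mem_Ioo
    constructor <;> nlinarith [Real.pi_pos]
  have ha : 0 < 2 * Real.pi * K * Real.cos (2 * Real.pi * (r / ((m : ℝ) - 1))) := by positivity
  have hform := dotProduct_hessU_vstate K hr (by omega : m ≠ 1)
  have hH := hessU_isHermitian K (vstate (m + 1) r)
  refine ⟨hH.eigenvalues, by simpa using hH.charpoly_eq, ?_⟩
  have hcard := hH.card_eigenvalues_of_index_one (x := fun i => ((i : ℕ) : ℝ)) (v := fun _ => 1)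
    (LinearMap.proj (R := ℝ) (φ := fun _ : Fin (m + 1) => ℝ) 0 -
      LinearMap.proj (R := ℝ) (φ := fun _ : Fin (m + 1) => ℝ) (Fin.last m)) ?_ ?_ ?_ ?_ ?_
  · rwa [Fintype.card_fin] at hcard
  · intro x hx
    rw [hform]
    refine mul_nonneg ha.le ?_
    simp only [LinearMap.sub_apply, LinearMap.proj_apply] at hx
    rw [signedCycleForm, hx, zero_mul, sub_zero]
    exact Finset.sum_nonneg fun i _ => mul_self_nonneg _
  · rw [hform]
    refine mul_neg_of_pos_of_neg ha ?_
    simp only [signedCycleForm, Fin.val_succ, Fin.val_castSucc, Fin.val_last, Fin.val_zero]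
    push_cast
    simp only [add_sub_cancel_left, mul_one, Finset.sum_const, Finset.card_univ,
      Fintype.card_fin, nsmul_eq_mul]
    nlinarith
  · exact fun h => one_ne_zero (congrFun h 0)
  · refine dotProduct_eq_zero _ fun x => ?_
    rw [dotProduct_comm, hform]
    simp [signedCycleForm]
  · intro y hy
    refine ⟨y 0, funext fun i => ?_⟩
    have h := eq_const_of_signedCycleForm_eq_zero (by omega : m ≠ 1) (y := y) (fun x => by
      have hx := hform x y
      rw [hy, dotProduct_zero] at hx
      exact (mul_eq_zero.mp hx.symm).resolve_left ha.ne') i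
    simpa using h
end

section
/- Let n ≥ 5 and let σ : ℤ/nℤ → {−1, 1} satisfy 1 ≤ #{i : σ_i = 1} ≤ n − 2 (i.e., σ takes the value −1 at least twice and the value 1 at least once). Then the symmetric matrix M(σ) has at least two strictly negative eigenvalues, counted with multiplicity; equivalently, there is a two-dimensional subspace of ℝ^n on which the quadratic form v ↦ vᵀ·M(σ)·v is negative definite. -/
/-- Cyclic predecessor on `Fin n`. -/
def fpred {n : ℕ} (i : Fin n) : Fin n := ⟨((i : ℕ) + n - 1) % n, Nat.mod_lt _ i.pos⟩

/-- The symmetric matrix `M(σ)` with `M(σ)_{ii} = σ_{i−1} + σ_i`,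
`M(σ)_{i,i+1} = M(σ)_{i+1,i} = −σ_i` (indices mod `n`), other entries `0`. -/
def Msigma (n : ℕ) (σ : Fin n → ℝ) : Matrix (Fin n) (Fin n) ℝ :=
  Matrix.of fun i j =>
    if i = j then σ (fpred i) + σ i
    else if j = fsucc i then -σ i
    else if i = fsucc j then -σ j
    else 0

open Finset Matrix

/-- A real symmetric matrix whose quadratic form is negative on all nontrivial combinations of
two vectors has at least two negative eigenvalues. -/
theorem Matrix.IsHermitian.two_le_card_neg_eigenvalues {ι : Type*} [Fintype ι] [DecidableEq ι]
    {A : Matrix ι ι ℝ} (hA : A.IsHermitian) (u w : ι → ℝ)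
    (h : ∀ s t : ℝ, (s ≠ 0 ∨ t ≠ 0) → (s • u + t • w) ⬝ᵥ A *ᵥ (s • u + t • w) < 0) :
    2 ≤ (univ.filter fun k => hA.eigenvalues k < 0).card := by
  let U : Matrix ι ι ℝ := (hA.eigenvectorUnitary : Matrix ι ι ℝ)
  have form (v : ι → ℝ) : v ⬝ᵥ A *ᵥ v = ∑ k, hA.eigenvalues k * (Uᵀ *ᵥ v) k ^ 2 := by
    have hspec : A = U * diagonal hA.eigenvalues * Uᵀ := by
      simpa [Unitary.conjStarAlgAut_apply, star_eq_conjTranspose, Function.comp_def,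
        conjTranspose_eq_transpose_of_trivial] using hA.spectral_theorem
    conv_lhs => rw [hspec]
    rw [← mulVec_mulVec, ← mulVec_mulVec, dotProduct_mulVec, ← mulVec_transpose, dotProduct]
    refine sum_congr rfl fun k _ => ?_
    rw [mulVec_diagonal]
    ring
  by_contra! hlt
  obtain ⟨f, hf⟩ : ∃ f : (ι → ℝ) →ₗ[ℝ] ℝ, ∀ v, f v = 0 → 0 ≤ v ⬝ᵥ A *ᵥ v := by
    have hone : (univ.filter fun k => hA.eigenvalues k < 0).card ≤ 1 := by omega
    by_cases hex : ∃ k, hA.eigenvalues k < 0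
    · obtain ⟨k₀, hk₀⟩ := hex
      refine ⟨LinearMap.proj k₀ ∘ₗ Uᵀ.mulVecLin, fun v hv => ?_⟩
      rw [form]
      refine sum_nonneg fun k _ => ?_
      by_cases hk : hA.eigenvalues k < 0
      · have : k = k₀ := card_le_one.mp hone k (by simpa using hk) k₀ (by simpa using hk₀)
        have hv : (Uᵀ *ᵥ v) k = 0 := by rw [this]; exact hv
        simp [hv]
      · exact mul_nonneg (not_lt.mp hk) (sq_nonneg _)
    · push Not at hex
      refine ⟨0, fun v _ => ?_⟩
      rw [form]
      exact sum_nonneg fun k _ => mul_nonneg (hex k) (sq_nonneg _)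
  by_cases hu : f u = 0
  · exact (h 1 0 (by simp)).not_ge (hf _ (by simp [hu]))
  · exact (h (f w) (-f u) (by simp [hu])).not_ge (hf _ (by simp; ring))

theorem fsucc_ne_self {n : ℕ} (hn : 2 ≤ n) (i : Fin n) : fsucc i ≠ i := by
  obtain ⟨i, hi⟩ := i
  simp only [fsucc, ne_eq, Fin.mk.injEq]
  rcases Nat.lt_or_ge (i + 1) n with h | h
  · rw [Nat.mod_eq_of_lt h]; omega
  · rw [show i + 1 = n by omega, Nat.mod_self]; omega

theorem fsucc_fsucc_ne_self {n : ℕ} (hn : 3 ≤ n) (i : Fin n) : fsucc (fsucc i) ≠ i := by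
  obtain ⟨i, hi⟩ := i
  simp only [fsucc, ne_eq, Fin.mk.injEq, Nat.mod_add_mod]
  rcases Nat.lt_or_ge (i + 1 + 1) n with h | h
  · rw [Nat.mod_eq_of_lt h]; omega
  · rw [Nat.mod_eq_sub_mod h, Nat.mod_eq_of_lt (by omega)]; omega

theorem fpred_fsucc {n : ℕ} (i : Fin n) : fpred (fsucc i) = i := by
  obtain ⟨i, hi⟩ := i
  simp only [fsucc, fpred, Fin.mk.injEq]
  rcases Nat.lt_or_ge (i + 1) n with h | h
  · rw [Nat.mod_eq_of_lt h, show i + 1 + n - 1 = i + n by omega, Nat.add_mod_right,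
      Nat.mod_eq_of_lt hi]
  · rw [show i + 1 = n by omega, Nat.mod_self, Nat.mod_eq_of_lt (by omega)]; omega

theorem fsucc_fpred {n : ℕ} (i : Fin n) : fsucc (fpred i) = i := by
  obtain ⟨i, hi⟩ := i
  simp only [fsucc, fpred, Fin.mk.injEq, Nat.mod_add_mod]
  rw [show i + n - 1 + 1 = i + n by omega, Nat.add_mod_right, Nat.mod_eq_of_lt hi]

/-- The cyclic shift of `Fin n`. -/
def fsuccEquiv (n : ℕ) : Fin n ≃ Fin n := ⟨fsucc, fpred, fpred_fsucc, fsucc_fpred⟩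

theorem Msigma_isHermitian {n : ℕ} (hn : 3 ≤ n) (σ : Fin n → ℝ) : (Msigma n σ).IsHermitian := by
  ext i j
  simp only [Msigma, conjTranspose_apply, of_apply, star_trivial]
  have := fsucc_fsucc_ne_self hn i
  grind

theorem Msigma_mulVec {n : ℕ} (hn : 3 ≤ n) (σ v : Fin n → ℝ) (i : Fin n) :
    (Msigma n σ *ᵥ v) i =
      σ i * (v i - v (fsucc i)) + σ (fpred i) * (v i - v (fpred i)) := by
  have entry (j : Fin n) : Msigma n σ i j * v j =
      (if j = i then (σ (fpred i) + σ i) * v i else 0) +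
        (if j = fsucc i then -σ i * v (fsucc i) else 0) +
        (if j = fpred i then -σ (fpred i) * v (fpred i) else 0) := by
    simp only [Msigma, of_apply]
    have h₁ := fsucc_ne_self (by omega) i
    have h₂ := fsucc_fsucc_ne_self hn (fpred i)
    have h₃ := fsucc_ne_self (by omega) (fpred i)
    have h₄ := fsucc_fpred i
    have h₅ := fpred_fsucc j
    grind
  rw [mulVec, dotProduct, sum_congr rfl fun j _ => entry j]
  simp only [sum_add_distrib, sum_ite_eq', mem_univ, if_true]
  ring

theorem dotProduct_Msigma_mulVec {n : ℕ} (hn : 3 ≤ n) (σ v : Fin n → ℝ) :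
    v ⬝ᵥ Msigma n σ *ᵥ v = ∑ i, σ i * (v i - v (fsucc i)) ^ 2 := by
  simp only [dotProduct, Msigma_mulVec hn, mul_add, sum_add_distrib]
  have shift : ∑ i, v i * (σ (fpred i) * (v i - v (fpred i))) =
      ∑ i, v (fsucc i) * (σ i * (v (fsucc i) - v i)) := by
    rw [← (fsuccEquiv n).sum_comp]
    simp [fsuccEquiv, fpred_fsucc]
  rw [shift, ← sum_add_distrib]
  exact sum_congr rfl fun i _ => by ring

theorem exists_sub_fsucc_eq {n : ℕ} (d : Fin n → ℝ) (hd : ∑ i, d i = 0) :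
    ∃ v : Fin n → ℝ, ∀ i, v i - v (fsucc i) = d i := by
  refine ⟨fun i => ∑ j, if j < i then -d j else 0, fun i => ?_⟩
  have key : ∑ j, (if j = i then d i else 0) = d i := by simp
  rw [← sum_sub_distrib]
  rcases Nat.lt_or_ge (i + 1) n with h | h
  · rw [← key]
    refine sum_congr rfl fun j _ => ?_
    have : (fsucc i : ℕ) = i + 1 := Nat.mod_eq_of_lt h
    simp only [Fin.lt_def, this, Fin.ext_iff]
    grind
  · have hs : (fsucc i : ℕ) = 0 := by
      simp [fsucc, show (i : ℕ) + 1 = n by omega]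
    rw [← sub_zero (d i), ← hd, ← key, ← sum_sub_distrib]
    refine sum_congr rfl fun j _ => ?_
    simp only [Fin.lt_def, hs, Fin.ext_iff]
    grind

theorem sum_signed_sq_neg {n : ℕ} (hn : 5 ≤ n) {σ : Fin n → ℝ} (hσ : ∀ i, σ i ≤ 1) {a b : Fin n}
    (hab : a ≠ b) (ha : σ a = -1) (hb : σ b = -1) {s t : ℝ} (hst : s ≠ 0 ∨ t ≠ 0) {d : Fin n → ℝ}
    (hda : d a = s) (hdb : d b = t)
    (hd : ∀ i, i ≠ a → i ≠ b → d i = -(s + t) / (n - 2)) :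
    ∑ i, σ i * d i ^ 2 < 0 := by
  set c : ℝ := -(s + t) / (n - 2) with hc
  have hn' : (5 : ℝ) ≤ n := by exact_mod_cast hn
  have hle : ∑ i, σ i * d i ^ 2 ≤ ∑ i, ((if i = a then -s ^ 2 - c ^ 2 else 0) +
      (if i = b then -t ^ 2 - c ^ 2 else 0) + c ^ 2) := by
    refine sum_le_sum fun i _ => ?_
    by_cases hia : i = a
    · subst hia; simp [hab, ha, hda]
    by_cases hib : i = b
    · subst hib; simp [hia, hb, hdb]
    simp only [hia, hib, if_false, hd i hia hib, zero_add]
    exact mul_le_of_le_one_left (sq_nonneg c) (hσ i)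
  refine hle.trans_lt ?_
  simp only [sum_add_distrib, sum_ite_eq', mem_univ, if_true, sum_const, card_univ,
    Fintype.card_fin, nsmul_eq_mul]
  have hcs : (n - 2) * c = -(s + t) := by
    rw [hc]; field_simp [show (n : ℝ) - 2 ≠ 0 by linarith]
  have hpos : 0 < s ^ 2 + t ^ 2 := by
    rcases hst with h | h <;> positivity
  have hbound : 3 * ((n - 2) * c ^ 2) ≤ (s + t) ^ 2 := by
    have : (s + t) ^ 2 = (n - 2) * ((n - 2) * c ^ 2) := by
      rw [← neg_sq, ← hcs]; ring
    rw [this]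
    exact mul_le_mul_of_nonneg_right (by linarith)
      (mul_nonneg (by linarith) (sq_nonneg c))
  nlinarith [sq_nonneg (s - t)]

/-- A unit mass at `a`, balanced by equal masses at the indices other than `a` and `b`. -/
noncomputable def balancedMass {n : ℕ} (a b i : Fin n) : ℝ :=
  if i = a then 1 else if i = b then 0 else -1 / (n - 2)

theorem sum_balancedMass {n : ℕ} (hn : 3 ≤ n) {a b : Fin n} (hab : a ≠ b) :
    ∑ i, balancedMass a b i = 0 := by
  have hn' : (3 : ℝ) ≤ n := by exact_mod_cast hn
  have entry (i : Fin n) : balancedMass a b i = (if i = a then 1 + 1 / ((n : ℝ) - 2) else 0) +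
      (if i = b then 1 / ((n : ℝ) - 2) else 0) + -1 / ((n : ℝ) - 2) := by
    unfold balancedMass
    split_ifs <;> first | (exfalso; grind) | ring
  simp only [entry, sum_add_distrib, sum_ite_eq', mem_univ, if_true, sum_const, card_univ,
    Fintype.card_fin, nsmul_eq_mul]
  field_simp [show (n : ℝ) - 2 ≠ 0 by linarith]
  ring

/-- For `n ≥ 5` and `σ : ℤ/nℤ → {−1,1}` taking the value `1` at least once and
the value `−1` at least twice (`1 ≤ #{i : σ_i = 1} ≤ n − 2`), the matrix `M(σ)`
has at least two strictly negative eigenvalues counted with multiplicity;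
equivalently, there is a two-dimensional subspace on which the quadratic form
`v ↦ vᵀ·M(σ)·v` is negative definite. -/
theorem Msigma_at_least_two_negative_eigenvalues (n : ℕ) (hn : 5 ≤ n)
    (σ : Fin n → ℝ) (hσ : ∀ i, σ i = 1 ∨ σ i = -1)
    (h₁ : 1 ≤ (Finset.univ.filter fun i => σ i = 1).card)
    (h₂ : (Finset.univ.filter fun i => σ i = 1).card ≤ n - 2) :
    ∃ μ : Fin n → ℝ,
      (Msigma n σ).charpoly = ∏ k : Fin n, (Polynomial.X - Polynomial.C (μ k)) ∧
      2 ≤ (Finset.univ.filter fun k => μ k < 0).card := by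
  have hA := Msigma_isHermitian (by omega) σ
  refine ⟨hA.eigenvalues, by simpa using hA.charpoly_eq, ?_⟩
  have hcard : 1 < (univ.filter fun i => ¬ σ i = 1).card := by
    have := card_filter_add_card_filter_not (s := (univ : Finset (Fin n))) (fun i => σ i = 1)
    rw [card_univ, Fintype.card_fin] at this
    omega
  obtain ⟨a, ha, b, hb, hab⟩ := one_lt_card.mp hcard
  have ha : σ a = -1 := (hσ a).resolve_left (by simpa using ha)
  have hb : σ b = -1 := (hσ b).resolve_left (by simpa using hb)
  obtain ⟨u, hu⟩ := exists_sub_fsucc_eq _ (sum_balancedMass (by omega) hab)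
  obtain ⟨w, hw⟩ := exists_sub_fsucc_eq _ (sum_balancedMass (by omega) hab.symm)
  refine hA.two_le_card_neg_eigenvalues u w fun s t hst => ?_
  rw [dotProduct_Msigma_mulVec (by omega)]
  have hdiff (i : Fin n) : (s • u + t • w) i - (s • u + t • w) (fsucc i) =
      s * balancedMass a b i + t * balancedMass b a i := by
    rw [← hu, ← hw]
    simp only [Pi.add_apply, Pi.smul_apply, smul_eq_mul]
    ring
  simp only [hdiff]
  refine sum_signed_sq_neg hn (fun i => ?_) hab ha hb hst ?_ ?_ fun i hia hib => ?_
  · rcases hσ i with h | h <;> norm_num [h]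
  · simp [balancedMass, hab]
  · simp [balancedMass, hab.symm]
  · simp only [balancedMass, hia, hib, if_false]
    ring
end

section
/- Define the curve u : ℝ → ℝ^n by u_i(s) = s·i/n for i = 0,…,n−1. Then for every s ∈ ℝ, the derivative of s ↦ U(u(s)) equals 2K·((n−1)/n)·sin(πs)·cos(π(n−2)s/n). -/
/-- The potential along the twist curve: `m` equal increments `s / (m + 1)`, and one closing
increment `-s * m / (m + 1)`. -/
theorem Unn_twist_curve (m : ℕ) (K s : ℝ) :
    Unn (m + 1) K (fun i => s * (i : ℕ) / (m + 1 : ℕ)) =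
      -(K / (2 * Real.pi)) * (m * Real.cos (2 * Real.pi / (m + 1) * s) +
        Real.cos (2 * Real.pi * m / (m + 1) * s)) := by
  have hm : (m : ℝ) + 1 ≠ 0 := by positivity
  unfold Unn
  rw [Fin.sum_univ_castSucc]
  congr 2
  · have h : ∀ i : Fin m, Real.cos (2 * Real.pi *
        (s * ((fsucc i.castSucc : Fin (m + 1)) : ℕ) / (m + 1 : ℕ) -
          s * (i.castSucc : ℕ) / (m + 1 : ℕ))) = Real.cos (2 * Real.pi / (m + 1) * s) := by
      intro i
      have hi : ((i : ℕ) + 1) % (m + 1) = i + 1 := Nat.mod_eq_of_lt (by omega)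
      simp only [fsucc, Fin.val_castSucc, hi]
      push_cast
      congr 1
      field_simp
      ring
    rw [Finset.sum_congr rfl fun i _ => h i]
    simp
  · simp only [fsucc, Fin.val_last, Nat.mod_self]
    rw [← Real.cos_neg]
    push_cast
    congr 1
    field_simp
    ring

/-- Along the curve `u_i(s) = s·i/n`, the derivative of `s ↦ U(u(s))` equals
`2K·((n−1)/n)·sin(πs)·cos(π(n−2)s/n)`. -/
theorem deriv_potential_along_twist_curve (n : ℕ) (hn : 3 ≤ n) (K : ℝ) (hK : 0 < K)
    (s : ℝ) :
    deriv (fun s : ℝ => Unn n K (fun i => s * (i : ℕ) / n)) s =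
      2 * K * (((n : ℝ) - 1) / n) * Real.sin (Real.pi * s) *
        Real.cos (Real.pi * ((n : ℝ) - 2) * s / n) := by
  obtain ⟨m, rfl⟩ : ∃ m, n = m + 1 := ⟨n - 1, by omega⟩
  have hm : (m : ℝ) + 1 ≠ 0 := by positivity
  have hpi : Real.pi ≠ 0 := Real.pi_ne_zero
  have hcos (c : ℝ) : HasDerivAt (fun x => Real.cos (c * x)) (-Real.sin (c * s) * c) s := by
    simpa using ((hasDerivAt_id s).const_mul c).cos
  have hU := (((hcos (2 * Real.pi / (m + 1))).const_mul (m : ℝ)).add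
    (hcos (2 * Real.pi * m / (m + 1)))).const_mul (-(K / (2 * Real.pi)))
  have hsum : Real.sin (2 * Real.pi / (m + 1) * s) + Real.sin (2 * Real.pi * m / (m + 1) * s) =
      2 * Real.sin (Real.pi * s) * Real.cos (Real.pi * ((m : ℝ) - 1) * s / (m + 1)) := by
    rw [show 2 * Real.pi / (m + 1) * s =
        Real.pi * s - Real.pi * ((m : ℝ) - 1) * s / (m + 1) by field_simp; ring,
      show 2 * Real.pi * m / (m + 1) * s =
        Real.pi * s + Real.pi * ((m : ℝ) - 1) * s / (m + 1) by field_simp; ring,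
      Real.sin_sub, Real.sin_add]
    ring
  rw [funext (Unn_twist_curve m K)]
  refine hU.deriv.trans ?_
  push_cast
  rw [show (m : ℝ) + 1 - 2 = m - 1 by ring]
  calc
    _ = K * (m / (m + 1)) * (Real.sin (2 * Real.pi / (m + 1) * s) +
          Real.sin (2 * Real.pi * m / (m + 1) * s)) := by
      generalize Real.sin (2 * Real.pi / (m + 1) * s) = a
      generalize Real.sin (2 * Real.pi * m / (m + 1) * s) = b
      field_simp
      ring
    _ = _ := by
      rw [hsum]
      ring
end

section
/- Let n ≥ 5, K > 0, and let q be an integer with 0 ≤ q and q + 1 < n/4. Then there exists a continuous path γ : [0,1] → ℝ^n with γ(0) = u^{(q)}, γ(1) = u^{(q+1)}, and U(γ(t)) ≤ U(v^{(q+1/2)}) for all t ∈ [0,1], with equality for exactly one t* ∈ (0,1), at which γ(t*) = v^{(q+1/2)}. In particular the communication height inf over continuous paths γ from u^{(q)} to u^{(q+1)} of the maximum of U along γ is at most U(v^{(q+1/2)}) = −(K(n−2)/(2π))·cos(π(2q+1)/(n−2)). -/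
/-- The cosine sum of the state `i ↦ s * i` on the cycle of length `n`. -/
noncomputable def lineEnergy (n : ℕ) (s : ℝ) : ℝ :=
  ((n : ℝ) - 1) * Real.cos (2 * Real.pi * s) + Real.cos (2 * Real.pi * (((n : ℝ) - 1) * s))

lemma Unn_line (n : ℕ) (hn : 1 ≤ n) (K s : ℝ) :
    Unn n K (fun i => s * (i : ℕ)) = -(K / (2 * Real.pi)) * lineEnergy n s := by
  obtain ⟨m, rfl⟩ : ∃ m, n = m + 1 := ⟨n - 1, by omega⟩
  unfold Unn lineEnergy
  congr 1
  rw [Fin.sum_univ_castSucc]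
  have hstep : ∀ i : Fin m, Real.cos (2 * Real.pi * (s * ((fsucc i.castSucc : Fin (m + 1)) : ℕ) -
      s * ((i.castSucc : Fin (m + 1)) : ℕ))) = Real.cos (2 * Real.pi * s) := by
    intro i
    have hval : ((fsucc i.castSucc : Fin (m + 1)) : ℕ) = i + 1 :=
      Nat.mod_eq_of_lt (Nat.succ_lt_succ i.isLt)
    rw [hval, Fin.val_castSucc]
    push_cast
    ring_nf
  have hlast : ((fsucc (Fin.last m) : Fin (m + 1)) : ℕ) = 0 := Nat.mod_self (m + 1)
  rw [Finset.sum_congr rfl fun i _ => hstep i]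
  simp only [hlast, Fin.val_last]
  rw [← Real.cos_neg (2 * _ * (_ - _))]
  simp only [Finset.sum_const, Finset.card_univ, Fintype.card_fin, nsmul_eq_mul]
  push_cast
  ring_nf

lemma hasDerivAt_lineEnergy (n : ℕ) (s : ℝ) :
    HasDerivAt (lineEnergy n) (-(4 * Real.pi * ((n : ℝ) - 1)) *
      (Real.sin (Real.pi * n * s) * Real.cos (Real.pi * ((n : ℝ) - 2) * s))) s := by
  have hcos : ∀ c : ℝ, HasDerivAt (fun x => Real.cos (c * x)) (-Real.sin (c * s) * c) s := by
    intro c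
    simpa using ((hasDerivAt_id s).const_mul c).cos
  have hsum := ((hcos (2 * Real.pi)).const_mul ((n : ℝ) - 1)).add
    (hcos (2 * Real.pi * ((n : ℝ) - 1)))
  have hfun : lineEnergy n = (fun x => ((n : ℝ) - 1) * Real.cos (2 * Real.pi * x)) +
      fun x => Real.cos (2 * Real.pi * ((n : ℝ) - 1) * x) := by
    funext x
    simp only [lineEnergy, Pi.add_apply, mul_assoc]
  rw [hfun]
  refine hsum.congr_deriv ?_
  have hleft : 2 * Real.pi * s = Real.pi * n * s - Real.pi * ((n : ℝ) - 2) * s := by ring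
  have hright : 2 * Real.pi * ((n : ℝ) - 1) * s =
      Real.pi * n * s + Real.pi * ((n : ℝ) - 2) * s := by ring
  rw [hleft, hright, Real.sin_sub, Real.sin_add]
  ring

lemma sin_mul_cos_sub_int_mul_pi (x y : ℝ) (q : ℤ) :
    Real.sin (x - q * Real.pi) * Real.cos (y - q * Real.pi) = Real.sin x * Real.cos y := by
  rw [Real.sin_sub_int_mul_pi, Real.cos_sub_int_mul_pi]
  have hsign : ((-1 : ℝ) ^ q) * (-1) ^ q = 1 := by
    rw [← mul_zpow]; simp
  linear_combination (Real.sin x * Real.cos y) * hsign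

/-- The slope `(q + 1/2)/(n - 2)` of the saddle candidate lies strictly between those of the two
adjacent twisted states. -/
lemma saddle_slope_mem_Ioo (n : ℕ) (hn : 5 ≤ n) (q : ℤ) (hq : 0 ≤ q)
    (hq' : ((q : ℝ) + 1) < (n : ℝ) / 4) :
    ((q : ℝ) + 1 / 2) / ((n : ℝ) - 2) ∈ Set.Ioo ((q : ℝ) / n) (((q : ℝ) + 1) / n) := by
  have hn' : (5 : ℝ) ≤ n := by exact_mod_cast hn
  have hq0 : (0 : ℝ) ≤ q := by exact_mod_cast hq
  constructor
  · rw [div_lt_div_iff₀ (by linarith) (by linarith)]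
    nlinarith
  · rw [div_lt_div_iff₀ (by linarith) (by linarith)]
    nlinarith

lemma lineEnergy_strictAntiOn (n : ℕ) (hn : 5 ≤ n) (q : ℤ) (hq : 0 ≤ q)
    (hq' : ((q : ℝ) + 1) < (n : ℝ) / 4) :
    StrictAntiOn (lineEnergy n) (Set.Icc ((q : ℝ) / n) (((q : ℝ) + 1 / 2) / ((n : ℝ) - 2))) := by
  have hn' : (5 : ℝ) ≤ n := by exact_mod_cast hn
  have hq0 : (0 : ℝ) ≤ q := by exact_mod_cast hq
  have hpi := Real.pi_pos
  have hmem := saddle_slope_mem_Ioo n hn q hq hq'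
  refine strictAntiOn_of_deriv_neg (convex_Icc _ _)
    (fun s _ => (hasDerivAt_lineEnergy n s).continuousAt.continuousWithinAt) fun s hs => ?_
  rw [interior_Icc] at hs
  rw [(hasDerivAt_lineEnergy n s).deriv, ← sin_mul_cos_sub_int_mul_pi _ _ q]
  have hlow : (q : ℝ) < s * n := (div_lt_iff₀ (by linarith)).1 hs.1
  have hupp : s * n < q + 1 := (lt_div_iff₀ (by linarith)).1 (hs.2.trans hmem.2)
  have hmid : s * ((n : ℝ) - 2) < q + 1 / 2 := (lt_div_iff₀ (by linarith)).1 hs.2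
  have hmid' : (q : ℝ) - 1 / 2 < s * ((n : ℝ) - 2) := by nlinarith
  refine mul_neg_of_neg_of_pos (by nlinarith) (mul_pos ?_ ?_)
  · exact Real.sin_pos_of_pos_of_lt_pi (by nlinarith) (by nlinarith)
  · exact Real.cos_pos_of_mem_Ioo ⟨by nlinarith, by nlinarith⟩

lemma lineEnergy_strictMonoOn (n : ℕ) (hn : 5 ≤ n) (q : ℤ) (hq : 0 ≤ q)
    (hq' : ((q : ℝ) + 1) < (n : ℝ) / 4) :
    StrictMonoOn (lineEnergy n)
      (Set.Icc (((q : ℝ) + 1 / 2) / ((n : ℝ) - 2)) (((q : ℝ) + 1) / n)) := by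
  have hn' : (5 : ℝ) ≤ n := by exact_mod_cast hn
  have hq0 : (0 : ℝ) ≤ q := by exact_mod_cast hq
  have hpi := Real.pi_pos
  have hmem := saddle_slope_mem_Ioo n hn q hq hq'
  refine strictMonoOn_of_deriv_pos (convex_Icc _ _)
    (fun s _ => (hasDerivAt_lineEnergy n s).continuousAt.continuousWithinAt) fun s hs => ?_
  rw [interior_Icc] at hs
  rw [(hasDerivAt_lineEnergy n s).deriv, ← sin_mul_cos_sub_int_mul_pi _ _ q]
  have hlow : (q : ℝ) < s * n := (div_lt_iff₀ (by linarith)).1 (hmem.1.trans hs.1)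
  have hupp : s * n < q + 1 := (lt_div_iff₀ (by linarith)).1 hs.2
  have hmid : (q : ℝ) + 1 / 2 < s * ((n : ℝ) - 2) := (div_lt_iff₀ (by linarith)).1 hs.1
  have hspos : 0 < s := by nlinarith
  refine mul_pos_of_neg_of_neg (by nlinarith) (mul_neg_of_pos_of_neg ?_ ?_)
  · exact Real.sin_pos_of_pos_of_lt_pi (by nlinarith) (by nlinarith)
  · exact Real.cos_neg_of_pi_div_two_lt_of_lt (by nlinarith) (by nlinarith)

lemma lineEnergy_saddle_lt (n : ℕ) (hn : 5 ≤ n) (q : ℤ) (hq : 0 ≤ q)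
    (hq' : ((q : ℝ) + 1) < (n : ℝ) / 4) {s : ℝ} (hs : s ∈ Set.Icc ((q : ℝ) / n) (((q : ℝ) + 1) / n))
    (hne : s ≠ ((q : ℝ) + 1 / 2) / ((n : ℝ) - 2)) :
    lineEnergy n (((q : ℝ) + 1 / 2) / ((n : ℝ) - 2)) < lineEnergy n s := by
  have hmem := saddle_slope_mem_Ioo n hn q hq hq'
  rcases hne.lt_or_gt with h | h
  · exact lineEnergy_strictAntiOn n hn q hq hq' ⟨hs.1, h.le⟩ ⟨hmem.1.le, le_rfl⟩ h
  · exact lineEnergy_strictMonoOn n hn q hq hq' ⟨le_rfl, hmem.2.le⟩ ⟨h.le, hs.2⟩ h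

lemma lineEnergy_saddle (n : ℕ) (hn : 5 ≤ n) (q : ℤ) :
    lineEnergy n (((q : ℝ) + 1 / 2) / ((n : ℝ) - 2)) =
      ((n : ℝ) - 2) * Real.cos (Real.pi * (2 * (q : ℝ) + 1) / ((n : ℝ) - 2)) := by
  have hn' : (5 : ℝ) ≤ n := by exact_mod_cast hn
  have hne : (n : ℝ) - 2 ≠ 0 := by linarith
  have hone : 2 * Real.pi * (((q : ℝ) + 1 / 2) / ((n : ℝ) - 2)) =
      Real.pi * (2 * (q : ℝ) + 1) / ((n : ℝ) - 2) := by
    field_simp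
  have hlast : 2 * Real.pi * (((n : ℝ) - 1) * (((q : ℝ) + 1 / 2) / ((n : ℝ) - 2))) =
      Real.pi * (2 * (q : ℝ) + 1) / ((n : ℝ) - 2) + Real.pi + q * (2 * Real.pi) := by
    field_simp
    ring
  rw [lineEnergy, hone, hlast, Real.cos_add_int_mul_two_pi, Real.cos_add_pi]
  ring

/-- For `n ≥ 5` and `0 ≤ q` with `q + 1 < n/4`, there is a continuous path from
`u^{(q)}` to `u^{(q+1)}` along which `U` stays below `U(v^{(q+1/2)})`, attaining
this value at exactly one interior time, at which the path passes through
`v^{(q+1/2)}`. In particular the communication height between `u^{(q)}` and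
`u^{(q+1)}` is at most `U(v^{(q+1/2)}) = −(K(n−2)/(2π))·cos(π(2q+1)/(n−2))`. -/
theorem minimal_path_through_saddle (n : ℕ) (hn : 5 ≤ n) (K : ℝ) (hK : 0 < K)
    (q : ℤ) (hq : 0 ≤ q) (hq' : ((q : ℝ) + 1) < (n : ℝ) / 4) :
    ∃ γ : ℝ → (Fin n → ℝ),
      ContinuousOn γ (Set.Icc 0 1) ∧
      γ 0 = twist n q ∧
      γ 1 = twist n (q + 1) ∧
      (∀ t ∈ Set.Icc (0 : ℝ) 1,
        Unn n K (γ t) ≤ Unn n K (vstate n ((q : ℝ) + 1 / 2))) ∧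
      (∃! t, t ∈ Set.Icc (0 : ℝ) 1 ∧
        Unn n K (γ t) = Unn n K (vstate n ((q : ℝ) + 1 / 2))) ∧
      (∀ t ∈ Set.Icc (0 : ℝ) 1,
        Unn n K (γ t) = Unn n K (vstate n ((q : ℝ) + 1 / 2)) →
          t ∈ Set.Ioo (0 : ℝ) 1 ∧ γ t = vstate n ((q : ℝ) + 1 / 2)) ∧
      Unn n K (vstate n ((q : ℝ) + 1 / 2)) =
        -(K * ((n : ℝ) - 2) / (2 * Real.pi)) *
          Real.cos (Real.pi * (2 * (q : ℝ) + 1) / ((n : ℝ) - 2)) := by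
  have hn' : (5 : ℝ) ≤ n := by exact_mod_cast hn
  have hn0 : (0 : ℝ) < n := by linarith
  have hK' : 0 < K / (2 * Real.pi) := by positivity
  have hmem := saddle_slope_mem_Ioo n hn q hq hq'
  have hv : vstate n ((q : ℝ) + 1 / 2) =
      fun i : Fin n => ((q : ℝ) + 1 / 2) / ((n : ℝ) - 2) * (i : ℕ) := by
    funext i
    simp only [vstate, div_mul_eq_mul_div]
  rw [hv]
  have hlt : ∀ t ∈ Set.Icc (0 : ℝ) 1, ((q : ℝ) + t) / n ≠ ((q : ℝ) + 1 / 2) / ((n : ℝ) - 2) →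
      Unn n K (fun i => ((q : ℝ) + t) / n * (i : ℕ)) <
        Unn n K (fun i => ((q : ℝ) + 1 / 2) / ((n : ℝ) - 2) * (i : ℕ)) := by
    intro t ht hne
    rw [Unn_line n (by omega), Unn_line n (by omega)]
    have hs : ((q : ℝ) + t) / n ∈ Set.Icc ((q : ℝ) / n) (((q : ℝ) + 1) / n) :=
      ⟨by gcongr; linarith [ht.1], by gcongr; exact ht.2⟩
    nlinarith [lineEnergy_saddle_lt n hn q hq hq' hs hne]
  have hslope : ∀ t ∈ Set.Icc (0 : ℝ) 1, Unn n K (fun i => ((q : ℝ) + t) / n * (i : ℕ)) =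
      Unn n K (fun i => ((q : ℝ) + 1 / 2) / ((n : ℝ) - 2) * (i : ℕ)) →
      ((q : ℝ) + t) / n = ((q : ℝ) + 1 / 2) / ((n : ℝ) - 2) := by
    intro t ht heq
    by_contra hne
    exact (hlt t ht hne).ne heq
  have hIoo : ∀ t : ℝ, ((q : ℝ) + t) / n = ((q : ℝ) + 1 / 2) / ((n : ℝ) - 2) →
      t ∈ Set.Ioo (0 : ℝ) 1 := by
    intro t ht
    rw [← ht, Set.mem_Ioo, div_lt_div_iff_of_pos_right hn0, div_lt_div_iff_of_pos_right hn0] at hmem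
    exact ⟨by linarith [hmem.1], by linarith [hmem.2]⟩
  have hstar : ((q : ℝ) + (n * (((q : ℝ) + 1 / 2) / ((n : ℝ) - 2)) - q)) / n =
      ((q : ℝ) + 1 / 2) / ((n : ℝ) - 2) := by
    rw [add_sub_cancel, mul_div_cancel_left₀ _ hn0.ne']
  refine ⟨fun t i => ((q : ℝ) + t) / n * (i : ℕ), ?_, ?_, ?_, ?_, ?_, ?_, ?_⟩
  · exact Continuous.continuousOn (by fun_prop)
  · funext i
    simp only [twist, add_zero, div_mul_eq_mul_div]
  · funext i
    simp only [twist, Int.cast_add, Int.cast_one, div_mul_eq_mul_div]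
  · intro t ht
    by_cases hne : ((q : ℝ) + t) / n = ((q : ℝ) + 1 / 2) / ((n : ℝ) - 2)
    · simp only [hne, le_refl]
    · exact (hlt t ht hne).le
  · refine ⟨n * (((q : ℝ) + 1 / 2) / ((n : ℝ) - 2)) - q,
      ⟨Set.Ioo_subset_Icc_self (hIoo _ hstar), by simp only [hstar]⟩, ?_⟩
    rintro t ⟨ht, heq⟩
    rw [← hslope t ht heq]
    field_simp
    ring
  · intro t ht heq
    have hs := hslope t ht heq
    exact ⟨hIoo t hs, by simp only [hs]⟩
  · rw [Unn_line n (by omega), lineEnergy_saddle n hn q]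
    ring
end

section
/- Let n ≥ 5 and K > 0. Define, for real q, ΔU(q) = (K/(2π))·[n·cos(2π(q+1)/n) − (n−2)·cos(π(2q+1)/(n−2))] (for integer q this equals U(v^{(q+1/2)}) − U(u^{(q+1)})). Then ΔU is strictly decreasing on the interval 0 ≤ q ≤ n/4 − 1. -/
/-- For `n ≥ 5` and `K > 0`, the barrier height
`ΔU(q) = (K/(2π))·[n·cos(2π(q+1)/n) − (n−2)·cos(π(2q+1)/(n−2))]`
is strictly decreasing on `0 ≤ q ≤ n/4 − 1`. -/
theorem barrier_height_strictly_decreasing (n : ℕ) (hn : 5 ≤ n) (K : ℝ) (hK : 0 < K) :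
    StrictAntiOn
      (fun q : ℝ => (K / (2 * Real.pi)) *
        ((n : ℝ) * Real.cos (2 * Real.pi * (q + 1) / n) -
          ((n : ℝ) - 2) * Real.cos (Real.pi * (2 * q + 1) / ((n : ℝ) - 2))))
      (Set.Icc (0 : ℝ) ((n : ℝ) / 4 - 1)) := by
  have hn5 : (5 : ℝ) ≤ n := by exact_mod_cast hn
  have hn0 : (0 : ℝ) < n := by linarith
  have hn2 : (0 : ℝ) < (n : ℝ) - 2 := by linarith
  have hpi := Real.pi_pos
  have hderiv : ∀ q : ℝ, HasDerivAt (fun q : ℝ => (K / (2 * Real.pi)) *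
      ((n : ℝ) * Real.cos (2 * Real.pi * (q + 1) / n) -
        ((n : ℝ) - 2) * Real.cos (Real.pi * (2 * q + 1) / ((n : ℝ) - 2))))
      (K * (Real.sin (Real.pi * (2 * q + 1) / ((n : ℝ) - 2)) -
        Real.sin (2 * Real.pi * (q + 1) / n))) q := by
    intro q
    have hα : HasDerivAt (fun q : ℝ => 2 * Real.pi * (q + 1) / n) (2 * Real.pi * 1 / n) q :=
      (((hasDerivAt_id q).add_const 1).const_mul (2 * Real.pi)).div_const _
    have hβ : HasDerivAt (fun q : ℝ => Real.pi * (2 * q + 1) / ((n : ℝ) - 2))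
        (Real.pi * (2 * 1) / ((n : ℝ) - 2)) q :=
      ((((hasDerivAt_id q).const_mul 2).add_const 1).const_mul Real.pi).div_const _
    refine (((hα.cos.const_mul (n : ℝ)).sub (hβ.cos.const_mul ((n : ℝ) - 2))).const_mul
      (K / (2 * Real.pi))).congr_deriv ?_
    generalize Real.sin (2 * Real.pi * (q + 1) / n) = s
    generalize Real.sin (Real.pi * (2 * q + 1) / ((n : ℝ) - 2)) = t
    field_simp
    ring
  refine strictAntiOn_of_deriv_neg (convex_Icc _ _)
    (fun q _ => (hderiv q).continuousAt.continuousWithinAt) fun q hq => ?_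
  rw [interior_Icc] at hq
  obtain ⟨hq0, hq1⟩ := hq
  rw [(hderiv q).deriv]
  refine mul_neg_of_pos_of_neg hK (sub_neg.2 (Real.sin_lt_sin_of_lt_of_le_pi_div_two ?_ ?_ ?_))
  · have : 0 ≤ Real.pi * (2 * q + 1) / ((n : ℝ) - 2) := by positivity
    linarith
  · rw [div_le_iff₀ hn0]
    nlinarith
  · rw [div_lt_div_iff₀ hn2 hn0]
    nlinarith
end

section
/- Fix an integer q ≥ 0 and a real K > 0. For integers n with n > 4q + 2 define H̄_q(n) = U(v^{(q+1/2)}) − U(u^{(q)}) = (K/(2π))·[n·cos(2πq/n) − (n−2)·cos(π(2q+1)/(n−2))]. Then, as n → ∞ along the integers, H̄_q(n) = K/π + (q + 1/4)·Kπ/n + O(1/n²); i.e., the function n ↦ H̄_q(n) − K/π − (q + 1/4)·Kπ/n is O(n^{−2}). -/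
open Filter

/-- Second-order expansion of `x * cos (a / x)` at infinity. -/
theorem mul_cos_div_sub_isBigO (a : ℝ) :
    (fun x : ℝ => x * Real.cos (a / x) - x + a ^ 2 / (2 * x))
      =O[atTop] (fun x : ℝ => 1 / x ^ 2) := by
  refine Asymptotics.IsBigO.of_bound (|a| ^ 4) ?_
  filter_upwards [eventually_ge_atTop |a|, eventually_ge_atTop 1] with x hax hx
  have hx0 : 0 < x := by linarith
  have hcos := Real.cos_bound (x := a / x) (by
    rw [abs_div, abs_of_pos hx0]
    exact div_le_one_of_le₀ hax hx0.le)
  rw [Real.norm_eq_abs, Real.norm_eq_abs, abs_of_pos (show 0 < 1 / x ^ 2 by positivity)]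
  have hfactor : x * Real.cos (a / x) - x + a ^ 2 / (2 * x)
      = x * (Real.cos (a / x) - (1 - (a / x) ^ 2 / 2)) := by
    field_simp
    ring
  rw [hfactor, abs_mul, abs_of_pos hx0]
  rw [abs_div, abs_of_pos hx0] at hcos
  calc x * |Real.cos (a / x) - (1 - (a / x) ^ 2 / 2)|
      ≤ x * ((|a| / x) ^ 4 * (5 / 96)) := by gcongr
    _ = |a| ^ 4 * (5 / 96) * (1 / x ^ 3) := by field_simp
    _ ≤ |a| ^ 4 * 1 * (1 / x ^ 2) := by
      gcongr
      · norm_num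
      · norm_num
    _ = |a| ^ 4 * (1 / x ^ 2) := by ring

/-- The sequence `1 / (n - 2) ^ 2` is `O(1 / n ^ 2)`. -/
theorem one_div_natCast_sub_two_sq_isBigO :
    (fun n : ℕ => 1 / ((n : ℝ) - 2) ^ 2) =O[atTop] (fun n : ℕ => 1 / (n : ℝ) ^ 2) := by
  refine Asymptotics.IsBigO.of_bound 4 ?_
  filter_upwards [eventually_ge_atTop 4] with n hn
  have hn' : (4 : ℝ) ≤ n := by exact_mod_cast hn
  have hn2 : 0 < (n : ℝ) - 2 := by linarith
  rw [Real.norm_of_nonneg (by positivity), Real.norm_of_nonneg (by positivity),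
    mul_one_div, div_le_div_iff₀ (by positivity) (by positivity)]
  nlinarith

/-- The difference `1 / (n - 2) - 1 / n` is `O(1 / n ^ 2)`. -/
theorem one_div_natCast_sub_two_sub_one_div_isBigO :
    (fun n : ℕ => 1 / ((n : ℝ) - 2) - 1 / (n : ℝ)) =O[atTop]
      (fun n : ℕ => 1 / (n : ℝ) ^ 2) := by
  refine Asymptotics.IsBigO.of_bound 4 ?_
  filter_upwards [eventually_ge_atTop 4] with n hn
  have hn' : (4 : ℝ) ≤ n := by exact_mod_cast hn
  have hn2 : 0 < (n : ℝ) - 2 := by linarith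
  have hn0 : 0 < (n : ℝ) := by linarith
  have hdiff : 1 / ((n : ℝ) - 2) - 1 / (n : ℝ) = 2 / (((n : ℝ) - 2) * n) := by
    field_simp
    ring
  rw [hdiff, Real.norm_of_nonneg (by positivity), Real.norm_of_nonneg (by positivity),
    mul_one_div, div_le_div_iff₀ (by positivity) (by positivity)]
  nlinarith

/-- Asymptotics of the barrier height
`H̄_q(n) = (K/(2π))·[n·cos(2πq/n) − (n−2)·cos(π(2q+1)/(n−2))]`:
for fixed `q ≥ 0`, `H̄_q(n) = K/π + (q + 1/4)·Kπ/n + O(1/n²)` as `n → ∞`. -/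
theorem barrier_height_Hbar_asymptotics (q : ℤ) (hq : 0 ≤ q) (K : ℝ) (hK : 0 < K) :
    (fun n : ℕ =>
        (K / (2 * Real.pi)) *
          ((n : ℝ) * Real.cos (2 * Real.pi * (q : ℝ) / n) -
            ((n : ℝ) - 2) * Real.cos (Real.pi * (2 * (q : ℝ) + 1) / ((n : ℝ) - 2))) -
        K / Real.pi - ((q : ℝ) + 1 / 4) * K * Real.pi / n)
      =O[atTop] (fun n : ℕ => 1 / (n : ℝ) ^ 2) := by
  set a : ℝ := 2 * Real.pi * (q : ℝ) with ha
  set b : ℝ := Real.pi * (2 * (q : ℝ) + 1) with hb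
  have hcast : Tendsto (fun n : ℕ => (n : ℝ)) atTop atTop := tendsto_natCast_atTop_atTop
  have hshift : Tendsto (fun n : ℕ => (n : ℝ) - 2) atTop atTop :=
    tendsto_atTop_add_const_right _ (-2) hcast
  have htwisted := (mul_cos_div_sub_isBigO a).comp_tendsto hcast
  have hsaddle := ((mul_cos_div_sub_isBigO b).comp_tendsto hshift).trans
    one_div_natCast_sub_two_sq_isBigO
  have hsum := ((htwisted.sub hsaddle).add
    (one_div_natCast_sub_two_sub_one_div_isBigO.const_mul_left (b ^ 2 / 2))).const_mul_left
      (K / (2 * Real.pi))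
  refine hsum.congr' ?_ EventuallyEq.rfl
  filter_upwards [eventually_ge_atTop 4] with n hn
  have hn' : (4 : ℝ) ≤ n := by exact_mod_cast hn
  have hn2 : (n : ℝ) - 2 ≠ 0 := by linarith
  have hn0 : (n : ℝ) ≠ 0 := by linarith
  have hpi := Real.pi_ne_zero
  simp only [Function.comp_apply]
  generalize Real.cos (a / n) = c
  generalize Real.cos (b / ((n : ℝ) - 2)) = d
  rw [ha, hb]
  field_simp
  ring
end

section
/- Let n ≥ 3, let L be the n×n periodic discrete Laplacian, ψ = e_0 − e_{n−1} ∈ ℝ^n, and M = L + 2ψψᵀ. Then det(εI − L) ≠ 0 for all sufficiently small ε ≠ 0, and the ratio det(εI − M)/det(εI − L) converges to −1 + 2/n as ε → 0 through nonzero values. Equivalently, the product of the n−1 nonzero eigenvalues of M (counted with multiplicity) divided by the product of the n−1 nonzero eigenvalues of L equals −1 + 2/n. -/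
open Filter

/-- The vector `ψ = e_0 − e_{n−1}`. -/
def psi (n : ℕ) : Fin n → ℝ :=
  fun i => if (i : ℕ) = 0 then 1 else if (i : ℕ) = n - 1 then -1 else 0

section

open Matrix

lemma det_sub_vecMulVec_of_mulVec_eq {ι R : Type*} [Fintype ι] [DecidableEq ι] [CommRing R]
    (A : Matrix ι ι R) {x u : ι → R} (v : ι → R) (h : A *ᵥ x = u) :
    (A - vecMulVec u v).det = A.det * (1 - v ⬝ᵥ x) := by
  have h1 : A - vecMulVec u v = A * (1 - vecMulVec x v) := by
    rw [mul_sub, mul_one, mul_vecMulVec, h]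
  have h2 : (1 - vecMulVec x v).det = 1 - v ⬝ᵥ x := by
    have := det_one_add_replicateCol_mul_replicateRow (ι := Unit) (-x) v
    rw [← vecMulVec_eq, neg_vecMulVec, ← sub_eq_add_neg] at this
    rw [this, dotProduct_neg, sub_eq_add_neg]
  rw [h1, det_mul, h2]

lemma Lmat_mulVec_apply (m : ℕ) (hm : 2 ≤ m) (v : Fin (m + 1) → ℝ) (i : Fin (m + 1)) :
    (Lmat (m + 1) *ᵥ v) i = v (i + 1) + v (i - 1) - 2 * v i := by
  have h1 : (1 : Fin (m + 1)) ≠ 0 := by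
    intro h; have := congrArg Fin.val h
    rw [Fin.val_one', Fin.val_zero, Nat.mod_eq_of_lt (by omega)] at this; omega
  have h2 : (1 : Fin (m + 1)) + 1 ≠ 0 := by
    intro h; have := congrArg Fin.val h
    rw [Fin.val_add, Fin.val_one', Fin.val_zero, Nat.mod_eq_of_lt (a := 1) (by omega),
      Nat.mod_eq_of_lt (by omega)] at this; omega
  have entry : ∀ j, Lmat (m + 1) i j =
      (if j = i + 1 then 1 else 0) + (if j = i - 1 then 1 else 0) - if j = i then 2 else 0 := by
    intro j
    have e : ∀ k : Fin (m + 1), (((k : ℕ) : ZMod (m + 1)) : Fin (m + 1)) = k :=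
      fun k => ZMod.natCast_zmod_val (n := m + 1) k
    have a1 : (((i : ℕ) : ZMod (m + 1)) - ((j : ℕ) : ZMod (m + 1)) = 1) ↔ j = i - 1 := by
      rw [e i, e j]
      change (i - j : Fin (m + 1)) = 1 ↔ _
      grind
    have a2 : (((i : ℕ) : ZMod (m + 1)) - ((j : ℕ) : ZMod (m + 1)) = -1) ↔ j = i + 1 := by
      rw [e i, e j]
      change (i - j : Fin (m + 1)) = -1 ↔ _
      grind
    simp only [Lmat, Matrix.of_apply, a1, a2]
    have n1 : i ≠ i + 1 := by simpa using h1
    have n2 : i ≠ i - 1 := by simpa [eq_sub_iff_add_eq] using h1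
    have n3 : i + 1 ≠ i - 1 := by
      rw [Ne, eq_sub_iff_add_eq, add_assoc]; simpa using h2
    rcases eq_or_ne i j with rfl | hij
    · simp [n1, n2]
    rw [if_neg hij, if_neg hij.symm, sub_zero]
    by_cases c1 : j = i + 1
    · simp [c1, n3]
    · simp [c1]
  simp only [mulVec, dotProduct, entry, sub_mul, add_mul, ite_mul, one_mul, zero_mul,
    Finset.sum_sub_distrib, Finset.sum_add_distrib, Finset.sum_ite_eq',
    Finset.mem_univ, if_true]

lemma sum_Lmat_mulVec (m : ℕ) (hm : 2 ≤ m) (v : Fin (m + 1) → ℝ) :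
    ∑ i, (Lmat (m + 1) *ᵥ v) i = 0 := by
  simp only [Lmat_mulVec_apply m hm, Finset.sum_sub_distrib, Finset.sum_add_distrib,
    ← Finset.mul_sum]
  have s1 : ∑ i, v (i + 1) = ∑ i, v i := Equiv.sum_comp (Equiv.addRight (1 : Fin (m + 1))) v
  have s2 : ∑ i, v (i - 1) = ∑ i, v i := Equiv.sum_comp (Equiv.subRight (1 : Fin (m + 1))) v
  rw [s1, s2]
  ring

lemma dotProduct_Lmat_mulVec (m : ℕ) (hm : 2 ≤ m) (v : Fin (m + 1) → ℝ) :
    v ⬝ᵥ (Lmat (m + 1) *ᵥ v) = -∑ i, (v (i + 1) - v i) ^ 2 := by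
  have s1 : ∑ i, v i * v (i - 1) = ∑ i, v (i + 1) * v i := by
    rw [← Equiv.sum_comp (Equiv.addRight (1 : Fin (m + 1)))]
    simp
  have s2 : ∑ i, v (i + 1) ^ 2 = ∑ i, v i ^ 2 :=
    Equiv.sum_comp (Equiv.addRight (1 : Fin (m + 1))) fun i => v i ^ 2
  have l : v ⬝ᵥ (Lmat (m + 1) *ᵥ v) =
      ∑ i, v (i + 1) * v i + ∑ i, v i * v (i - 1) - 2 * ∑ i, v i ^ 2 := by
    simp only [dotProduct, Lmat_mulVec_apply m hm, Finset.mul_sum, ← Finset.sum_add_distrib,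
      ← Finset.sum_sub_distrib]
    exact Finset.sum_congr rfl fun i _ => by ring
  have r : ∑ i, (v (i + 1) - v i) ^ 2 =
      ∑ i, v (i + 1) ^ 2 + ∑ i, v i ^ 2 - 2 * ∑ i, v (i + 1) * v i := by
    simp only [Finset.mul_sum, ← Finset.sum_add_distrib, ← Finset.sum_sub_distrib]
    exact Finset.sum_congr rfl fun i _ => by ring
  rw [l, r, s1, s2]
  ring

lemma eq_const_of_Lmat_mulVec_eq_zero (m : ℕ) (hm : 2 ≤ m) {v : Fin (m + 1) → ℝ}
    (h : Lmat (m + 1) *ᵥ v = 0) (i : Fin (m + 1)) : v i = v 0 := by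
  have hs := dotProduct_Lmat_mulVec m hm v
  rw [h, dotProduct_zero, zero_eq_neg, Finset.sum_eq_zero_iff_of_nonneg fun _ _ => sq_nonneg _]
    at hs
  induction i using Fin.induction with
  | zero => rfl
  | succ i ih =>
    have := hs i.castSucc (Finset.mem_univ _)
    rw [Fin.coeSucc_eq_succ] at this
    linarith [pow_eq_zero_iff two_ne_zero |>.1 this]

/-- The resolvent matrix `εI − L`, shifted by the all-ones matrix to make it invertible
at `ε = 0`. -/
noncomputable def shiftedResolvent (n : ℕ) (ε : ℝ) : Matrix (Fin n) (Fin n) ℝ :=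
  ε • (1 : Matrix (Fin n) (Fin n) ℝ) - Lmat n + vecMulVec 1 1

lemma continuous_shiftedResolvent (n : ℕ) : Continuous (shiftedResolvent n) := by
  unfold shiftedResolvent
  fun_prop

lemma shiftedResolvent_mulVec_apply (n : ℕ) (ε : ℝ) (v : Fin n → ℝ) (i : Fin n) :
    (shiftedResolvent n ε *ᵥ v) i = ε * v i - (Lmat n *ᵥ v) i + ∑ j, v j := by
  rw [shiftedResolvent, add_mulVec, sub_mulVec, smul_mulVec, vecMulVec_mulVec, one_mulVec]
  simp [one_dotProduct]

lemma sum_shiftedResolvent_mulVec (m : ℕ) (hm : 2 ≤ m) (ε : ℝ) (v : Fin (m + 1) → ℝ) :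
    ∑ i, (shiftedResolvent (m + 1) ε *ᵥ v) i = (ε + (m + 1)) * ∑ i, v i := by
  simp only [shiftedResolvent_mulVec_apply, Finset.sum_add_distrib, Finset.sum_sub_distrib,
    sum_Lmat_mulVec m hm, ← Finset.mul_sum, Finset.sum_const, Finset.card_univ, Fintype.card_fin,
    nsmul_eq_mul]
  push_cast
  ring

lemma det_shiftedResolvent_zero_ne_zero (m : ℕ) (hm : 2 ≤ m) :
    (shiftedResolvent (m + 1) 0).det ≠ 0 := by
  intro h
  obtain ⟨v, hv, hv0⟩ := exists_mulVec_eq_zero_iff.2 h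
  have hs : ∑ i, v i = 0 := by
    have := sum_shiftedResolvent_mulVec m hm 0 v
    rw [hv0] at this
    simp only [Pi.zero_apply, Finset.sum_const_zero, zero_add, zero_eq_mul] at this
    exact this.resolve_left (by positivity)
  have hL : Lmat (m + 1) *ᵥ v = 0 := by
    ext i
    have := shiftedResolvent_mulVec_apply (m + 1) 0 v i
    rw [hv0, hs] at this
    simpa using this
  have hc := eq_const_of_Lmat_mulVec_eq_zero m hm hL
  have h0 : v 0 = 0 := by
    simp only [hc, Finset.sum_const, Finset.card_univ, Fintype.card_fin, nsmul_eq_mul,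
      mul_eq_zero] at hs
    exact hs.resolve_left (by positivity)
  exact hv (funext fun i => by rw [hc, h0]; rfl)

lemma det_smul_one_sub_Lmat (m : ℕ) (hm : 2 ≤ m) {ε : ℝ} (hε : ε + (m + 1) ≠ 0) :
    (ε • (1 : Matrix (Fin (m + 1)) (Fin (m + 1)) ℝ) - Lmat (m + 1)).det =
      (shiftedResolvent (m + 1) ε).det * (ε / (ε + (m + 1))) := by
  have h : shiftedResolvent (m + 1) ε *ᵥ (fun _ => (ε + (m + 1))⁻¹) = 1 := by
    ext i
    rw [shiftedResolvent_mulVec_apply, Lmat_mulVec_apply m hm]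
    simp
    field_simp
    ring
  have := det_sub_vecMulVec_of_mulVec_eq _ 1 h
  rw [shiftedResolvent, add_sub_cancel_right, ← shiftedResolvent] at this
  rw [this]
  simp [one_dotProduct]
  left
  field_simp
  ring

lemma psi_dotProduct (m : ℕ) (hm : 2 ≤ m) (v : Fin (m + 1) → ℝ) :
    psi (m + 1) ⬝ᵥ v = v 0 - v (Fin.last m) := by
  have h : ∀ i, psi (m + 1) i = (if i = 0 then 1 else 0) - (if i = Fin.last m then 1 else 0) := by
    intro i
    simp only [psi, Fin.ext_iff, Fin.val_zero, Fin.val_last, Nat.add_sub_cancel]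
    split_ifs <;> first | omega | norm_num
  simp only [dotProduct, h, sub_mul, ite_mul, one_mul, zero_mul, Finset.sum_sub_distrib,
    Finset.sum_ite_eq', Finset.mem_univ, if_true]

lemma sum_psi (m : ℕ) (hm : 2 ≤ m) : ∑ i, psi (m + 1) i = 0 := by
  simpa [dotProduct_one] using psi_dotProduct m hm 1

/-- The solution of `-L φ = ψ` with vanishing sum. -/
noncomputable def potential (m : ℕ) (i : Fin (m + 1)) : ℝ := (m / 2 - (i : ℕ)) / (m + 1)

lemma sum_potential (m : ℕ) : ∑ i, potential m i = 0 := by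
  have gauss : ∀ k : ℕ, ∑ i ∈ Finset.range k, (i : ℝ) = k * (k - 1) / 2 := by
    intro k
    induction k with
    | zero => simp
    | succ k ih => rw [Finset.sum_range_succ, ih]; push_cast; ring
  simp only [potential, ← Finset.sum_div, Finset.sum_sub_distrib,
    Fin.sum_univ_eq_sum_range (fun i => (i : ℝ)), gauss, Finset.sum_const, Finset.card_univ,
    Fintype.card_fin, nsmul_eq_mul]
  push_cast
  ring

lemma Lmat_mulVec_potential (m : ℕ) (hm : 2 ≤ m) :
    Lmat (m + 1) *ᵥ potential m = -psi (m + 1) := by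
  ext i
  rw [Lmat_mulVec_apply m hm, Pi.neg_apply]
  have hsucc : ((i + 1 : Fin (m + 1)) : ℕ) = if (i : ℕ) = m then 0 else (i : ℕ) + 1 := by
    simp only [Fin.val_add_one, Fin.ext_iff, Fin.val_last]
  have hpred : ((i - 1 : Fin (m + 1)) : ℕ) = if (i : ℕ) = 0 then m else (i : ℕ) - 1 := by
    simp only [Fin.coe_sub_one, Fin.ext_iff, Fin.val_zero]
  have hm' : (m : ℝ) + 1 ≠ 0 := by positivity
  simp only [potential, psi, hsucc, hpred, Nat.add_sub_cancel]
  by_cases h0 : (i : ℕ) = 0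
  · have h1 : (0 : ℕ) ≠ m := by omega
    simp only [h0, h1, if_true, if_false]
    field_simp
    push_cast
    ring
  · by_cases hl : (i : ℕ) = m
    · have h1 : m ≠ 0 := by omega
      simp only [hl, h1, if_true, if_false]
      rw [Nat.cast_sub (by omega)]
      field_simp
      push_cast
      ring
    · simp only [h0, hl, if_false]
      rw [Nat.cast_sub (by omega)]
      field_simp
      push_cast
      ring

lemma shiftedResolvent_zero_mulVec_potential (m : ℕ) (hm : 2 ≤ m) :
    shiftedResolvent (m + 1) 0 *ᵥ potential m = psi (m + 1) := by
  ext i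
  rw [shiftedResolvent_mulVec_apply, Lmat_mulVec_potential m hm, sum_potential]
  simp

lemma det_smul_one_sub_Lmat_add (m : ℕ) (hm : 2 ≤ m) {ε : ℝ} (hε : ε + (m + 1) ≠ 0)
    (hB : (shiftedResolvent (m + 1) ε).det ≠ 0) :
    (ε • (1 : Matrix (Fin (m + 1)) (Fin (m + 1)) ℝ) -
        (Lmat (m + 1) + (2 : ℝ) • vecMulVec (psi (m + 1)) (psi (m + 1)))).det =
      (ε • (1 : Matrix (Fin (m + 1)) (Fin (m + 1)) ℝ) - Lmat (m + 1)).det *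
        (1 - 2 * psi (m + 1) ⬝ᵥ ((shiftedResolvent (m + 1) ε)⁻¹ *ᵥ psi (m + 1))) := by
  set x := (shiftedResolvent (m + 1) ε)⁻¹ *ᵥ psi (m + 1) with hx
  have hBx : shiftedResolvent (m + 1) ε *ᵥ x = psi (m + 1) := by
    rw [hx, mulVec_mulVec, mul_nonsing_inv _ (isUnit_iff_ne_zero.2 hB), one_mulVec]
  have hs : ∑ i, x i = 0 := by
    have := sum_shiftedResolvent_mulVec m hm ε x
    rw [hBx, sum_psi m hm, zero_eq_mul] at this
    exact this.resolve_left hε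
  have hA : (ε • (1 : Matrix (Fin (m + 1)) (Fin (m + 1)) ℝ) - Lmat (m + 1)) *ᵥ x =
      psi (m + 1) := by
    ext i
    have := shiftedResolvent_mulVec_apply (m + 1) ε x i
    rw [hBx, hs, add_zero] at this
    simp [this, sub_mulVec, smul_mulVec]
  have := det_sub_vecMulVec_of_mulVec_eq _ ((2 : ℝ) • psi (m + 1)) hA
  rw [vecMulVec_smul, smul_dotProduct, smul_eq_mul] at this
  rw [← sub_sub, this]

lemma tendsto_psi_dotProduct_shiftedResolvent_inv (m : ℕ) (hm : 2 ≤ m) :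
    Tendsto (fun ε => psi (m + 1) ⬝ᵥ ((shiftedResolvent (m + 1) ε)⁻¹ *ᵥ psi (m + 1)))
      (nhds 0) (nhds (m / (m + 1))) := by
  have h0 := det_shiftedResolvent_zero_ne_zero m hm
  have hc := continuous_shiftedResolvent (m + 1)
  have hval : psi (m + 1) ⬝ᵥ ((shiftedResolvent (m + 1) 0)⁻¹ *ᵥ psi (m + 1)) =
      (m / (m + 1) : ℝ) := by
    nth_rw 2 [← shiftedResolvent_zero_mulVec_potential m hm]
    rw [mulVec_mulVec, nonsing_inv_mul _ (isUnit_iff_ne_zero.2 h0), one_mulVec,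
      psi_dotProduct m hm]
    simp only [potential, Fin.val_zero, Fin.val_last]
    push_cast
    ring
  rw [← hval]
  simp only [inv_def, Ring.inverse_eq_inv', smul_mulVec, dotProduct_smul, smul_eq_mul]
  exact (hc.matrix_det.continuousAt.inv₀ h0).mul
    (continuous_const.dotProduct
      (hc.matrix_adjugate.matrix_mulVec continuous_const)).continuousAt

end

/-- For `M = L + 2ψψᵀ`: `det(εI − L) ≠ 0` for all sufficiently small `ε ≠ 0`,
and `det(εI − M)/det(εI − L) → −1 + 2/n` as `ε → 0` through nonzero values,
i.e. the ratio of the products of nonzero eigenvalues of `M` and `L` is `−1 + 2/n`. -/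
theorem det_ratio_limit (n : ℕ) (hn : 3 ≤ n) :
    (∀ᶠ ε : ℝ in nhdsWithin 0 {0}ᶜ,
      (ε • (1 : Matrix (Fin n) (Fin n) ℝ) - Lmat n).det ≠ 0) ∧
    Tendsto
      (fun ε : ℝ =>
        (ε • (1 : Matrix (Fin n) (Fin n) ℝ) -
            (Lmat n + (2 : ℝ) • Matrix.vecMulVec (psi n) (psi n))).det /
          (ε • (1 : Matrix (Fin n) (Fin n) ℝ) - Lmat n).det)
      (nhdsWithin 0 {0}ᶜ) (nhds (-1 + 2 / (n : ℝ))) := by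
  obtain ⟨m, rfl⟩ : ∃ m, n = m + 1 := ⟨n - 1, by omega⟩
  have hm : 2 ≤ m := by omega
  have hB : ∀ᶠ ε in nhdsWithin (0 : ℝ) {0}ᶜ, (shiftedResolvent (m + 1) ε).det ≠ 0 :=
    ((continuous_shiftedResolvent (m + 1)).matrix_det.continuousAt.eventually_ne
      (det_shiftedResolvent_zero_ne_zero m hm)).filter_mono nhdsWithin_le_nhds
  have hε : ∀ᶠ ε : ℝ in nhdsWithin 0 {0}ᶜ, ε + (m + 1) ≠ 0 := by
    have hc : ContinuousAt (fun ε : ℝ => ε + (m + 1)) 0 := by fun_prop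
    exact (hc.eventually_ne (by positivity)).filter_mono nhdsWithin_le_nhds
  have hL : ∀ᶠ ε : ℝ in nhdsWithin 0 {0}ᶜ,
      (ε • (1 : Matrix (Fin (m + 1)) (Fin (m + 1)) ℝ) - Lmat (m + 1)).det ≠ 0 := by
    filter_upwards [hB, hε, self_mem_nhdsWithin] with ε h1 h2 h3
    rw [det_smul_one_sub_Lmat m hm h2]
    exact mul_ne_zero h1 (div_ne_zero h3 h2)
  refine ⟨hL, ?_⟩
  have hlim := ((tendsto_psi_dotProduct_shiftedResolvent_inv m hm).const_mul 2).const_sub 1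
  have hval : (1 - 2 * (m / (m + 1)) : ℝ) = -1 + 2 / ((m + 1 : ℕ) : ℝ) := by
    push_cast
    field_simp
    ring
  rw [hval] at hlim
  refine (hlim.mono_left nhdsWithin_le_nhds).congr' ?_
  filter_upwards [hB, hε, hL] with ε h1 h2 h3
  rw [det_smul_one_sub_Lmat_add m hm h2 h1, mul_div_cancel_left₀ _ h3]
end

section
/- Let n ≥ 5 and M = D + ψψᵀ. Then M has exactly one strictly positive eigenvalue μ (counted with multiplicity), and it satisfies 4/3 − 3^{−(n−3)} ≤ μ ≤ 4/3. Equivalently, the unique strictly negative eigenvalue ν_1 of −M satisfies −4/3 ≤ ν_1 ≤ −4/3 + 3^{−(n−3)}. -/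
/-- The `n×n` Neumann discrete Laplacian. -/
def Dmat (n : ℕ) : Matrix (Fin n) (Fin n) ℝ :=
  Matrix.of fun i j =>
    if i = j then (if (i : ℕ) = 0 ∨ (i : ℕ) = n - 1 then -1 else -2)
    else if (i : ℕ) + 1 = (j : ℕ) ∨ (j : ℕ) + 1 = (i : ℕ) then 1
    else 0

open Matrix in
/-- The spectral theorem for real symmetric matrices, in coordinates. -/
lemma Matrix.IsSymm.exists_eigenpairs {ι : Type*} [Fintype ι] [DecidableEq ι]
    {A : Matrix ι ι ℝ} (hA : A.IsSymm) :
    ∃ (μ : ι → ℝ) (u : ι → ι → ℝ),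
      A.charpoly = ∏ k, (Polynomial.X - Polynomial.C (μ k)) ∧
      (∀ k, A *ᵥ u k = μ k • u k) ∧
      (∀ k l, u k ⬝ᵥ u l = if k = l then 1 else 0) ∧
      ∀ x y, ∑ k, (x ⬝ᵥ u k) * (u k ⬝ᵥ y) = x ⬝ᵥ y := by
  have hH : A.IsHermitian := by
    rw [Matrix.IsHermitian, conjTranspose_eq_transpose_of_trivial]
    exact hA
  refine ⟨hH.eigenvalues, fun k => (hH.eigenvectorBasis k).ofLp, ?_, ?_, ?_, ?_⟩
  · simpa using hH.charpoly_eq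
  · intro k
    exact hH.mulVec_eigenvectorBasis k
  · intro k l
    have h := orthonormal_iff_ite.mp hH.eigenvectorBasis.orthonormal l k
    rw [EuclideanSpace.inner_eq_star_dotProduct] at h
    simpa [eq_comm] using h
  · intro x y
    have h := hH.eigenvectorBasis.sum_inner_mul_inner (WithLp.toLp 2 x) (WithLp.toLp 2 y)
    simp only [EuclideanSpace.inner_eq_star_dotProduct, star_trivial] at h
    rw [dotProduct_comm x y, ← h]
    refine Finset.sum_congr rfl fun k _ => ?_
    rw [dotProduct_comm x, dotProduct_comm y]

open Matrix in
/-- A symmetric matrix has an eigenvalue at least as large as any of its Rayleigh quotients. -/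
lemma exists_le_eigenvalue {ι : Type*} [Fintype ι] {A : Matrix ι ι ℝ} (hA : A.IsSymm)
    {μ : ι → ℝ} {u : ι → ι → ℝ} (hu : ∀ k, A *ᵥ u k = μ k • u k)
    (hsum : ∀ x y, ∑ k, (x ⬝ᵥ u k) * (u k ⬝ᵥ y) = x ⬝ᵥ y)
    {c : ℝ} {w : ι → ℝ} (hw : 0 < w ⬝ᵥ w) (h : c * (w ⬝ᵥ w) ≤ w ⬝ᵥ A *ᵥ w) :
    ∃ k, c ≤ μ k := by
  by_contra! hlt
  have hterm : ∀ k, u k ⬝ᵥ A *ᵥ w = μ k * (w ⬝ᵥ u k) := fun k => by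
    rw [dotProduct_mulVec, ← mulVec_transpose, hA.eq, hu, smul_dotProduct, smul_eq_mul,
      dotProduct_comm]
  have hnonneg : ∀ k ∈ Finset.univ, 0 ≤ (c - μ k) * (w ⬝ᵥ u k) ^ 2 := fun k _ =>
    mul_nonneg (sub_nonneg.mpr (hlt k).le) (sq_nonneg _)
  have hle : ∑ k, (c - μ k) * (w ⬝ᵥ u k) ^ 2 ≤ 0 := by
    rw [← hsum w w, ← hsum w (A *ᵥ w), Finset.mul_sum, ← sub_nonpos,
      ← Finset.sum_sub_distrib] at h
    refine le_of_eq_of_le (Finset.sum_congr rfl fun k _ => ?_) h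
    rw [hterm, dotProduct_comm (u k) w]
    ring
  have hzero := (Finset.sum_eq_zero_iff_of_nonneg hnonneg).mp
    (le_antisymm hle (Finset.sum_nonneg hnonneg))
  refine hw.ne' ((hsum w w).symm.trans (Finset.sum_eq_zero fun k hk => ?_))
  have := (mul_eq_zero.mp (hzero k hk)).resolve_left (sub_pos.mpr (hlt k)).ne'
  rw [pow_eq_zero_iff two_ne_zero] at this
  rw [this, zero_mul]

lemma Dmat_isSymm (n : ℕ) : (Dmat n).IsSymm := by
  ext i j
  simp only [Dmat, Matrix.transpose_apply, Matrix.of_apply]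
  by_cases h : i = j
  · simp [h]
  · rw [if_neg h, if_neg (Ne.symm h)]
    simp only [or_comm]

open Matrix in
lemma Dmat_mulVec {m : ℕ} (hm : 1 ≤ m) (f : ℕ → ℝ) (i : Fin (m + 1)) :
    (Dmat (m + 1) *ᵥ fun j => f j) i =
      (if (i : ℕ) = 0 then 0 else f (i - 1) - f i) +
        (if (i : ℕ) = m then 0 else f (i + 1) - f i) := by
  obtain ⟨i, hi⟩ := i
  have hentry : ∀ j : Fin (m + 1), Dmat (m + 1) ⟨i, hi⟩ j * f j =
      (if i = 0 then 0 else if i - 1 = (j : ℕ) then f j else 0) +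
      (if i + 1 = (j : ℕ) then f j else 0) +
      (if i = (j : ℕ) then
        (if i = 0 then 0 else - f j) + (if i = m then 0 else - f j) else 0) := by
    rintro ⟨j, hj⟩
    simp only [Dmat, Matrix.of_apply, Fin.mk.injEq, Nat.add_sub_cancel]
    split_ifs <;> first | omega | (subst_vars; ring)
  simp only [mulVec, dotProduct]
  rw [Finset.sum_congr rfl fun j _ => hentry j,
    Fin.sum_univ_eq_sum_range (fun j => (if i = 0 then 0 else if i - 1 = j then f j else 0) +
      (if i + 1 = j then f j else 0) +
      (if i = j then (if i = 0 then 0 else - f j) + (if i = m then 0 else - f j) else 0)),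
    Finset.sum_add_distrib, Finset.sum_add_distrib]
  have h1 : ∑ j ∈ Finset.range (m + 1), (if i = 0 then 0 else if i - 1 = j then f j else 0) =
      if i = 0 then 0 else f (i - 1) := by
    split_ifs with h
    · simp
    · rw [Finset.sum_ite_eq, if_pos (Finset.mem_range.mpr (by omega))]
  rw [h1, Finset.sum_ite_eq, Finset.sum_ite_eq, if_pos (Finset.mem_range.mpr hi)]
  simp only [Finset.mem_range]
  split_ifs <;> first | omega | ring

open Matrix in
lemma dotProduct_Dmat_mulVec_nonpos {m : ℕ} (hm : 1 ≤ m) (x : Fin (m + 1) → ℝ) :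
    x ⬝ᵥ Dmat (m + 1) *ᵥ x ≤ 0 := by
  have hrow : ∀ i, ∑ j, Dmat (m + 1) i j = 0 := fun i => by
    simpa [mulVec, dotProduct] using Dmat_mulVec hm (fun _ => 1) i
  have hcol : ∀ j, ∑ i, Dmat (m + 1) i j = 0 := fun j => by
    rw [← hrow j]
    exact Finset.sum_congr rfl fun i _ => (Dmat_isSymm _).apply j i
  have hform : x ⬝ᵥ Dmat (m + 1) *ᵥ x =
      -(1 / 2) * ∑ i, ∑ j, Dmat (m + 1) i j * (x i - x j) ^ 2 := by
    have hexp : ∑ i, ∑ j, Dmat (m + 1) i j * (x i - x j) ^ 2 =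
        ∑ i, ∑ j, (Dmat (m + 1) i j * x i ^ 2 + Dmat (m + 1) i j * x j ^ 2 -
          2 * (x i * (Dmat (m + 1) i j * x j))) :=
      Finset.sum_congr rfl fun i _ => Finset.sum_congr rfl fun j _ => by ring
    have h1 : ∑ i, ∑ j, Dmat (m + 1) i j * x i ^ 2 = 0 := by
      simp [← Finset.sum_mul, hrow]
    have h2 : ∑ i, ∑ j, Dmat (m + 1) i j * x j ^ 2 = 0 := by
      rw [Finset.sum_comm]
      simp [← Finset.sum_mul, hcol]
    rw [hexp]
    simp only [Finset.sum_add_distrib, Finset.sum_sub_distrib, h1, h2, ← Finset.mul_sum]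
    simp only [mulVec, dotProduct]
    ring
  rw [hform]
  have : 0 ≤ ∑ i, ∑ j, Dmat (m + 1) i j * (x i - x j) ^ 2 := by
    refine Finset.sum_nonneg fun i _ => Finset.sum_nonneg fun j _ => ?_
    by_cases h : i = j
    · simp [h]
    · refine mul_nonneg ?_ (sq_nonneg _)
      simp only [Dmat, Matrix.of_apply, if_neg h]
      split_ifs <;> norm_num
  linarith

open Matrix in
lemma dotProduct_psi {m : ℕ} (hm : 1 ≤ m) (x : Fin (m + 1) → ℝ) :
    x ⬝ᵥ psi (m + 1) = x 0 - x (Fin.last m) := by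
  have hpsi : ∀ i : Fin (m + 1), x i * psi (m + 1) i =
      (if i = 0 then x i else 0) - (if i = Fin.last m then x i else 0) := fun i => by
    simp only [psi, Fin.ext_iff, Fin.val_zero, Fin.val_last, Nat.add_sub_cancel]
    split_ifs <;> first | omega | ring
  simp [dotProduct, hpsi]

/-- The antisymmetric exponential profile approximating the top eigenvector. -/
def expProfile (m : ℕ) : Fin (m + 1) → ℝ :=
  fun i => 3 ^ (m - i : ℕ) - 3 ^ (i : ℕ)

open Matrix in
lemma Dmat_mulVec_expProfile {m : ℕ} (hm : 1 ≤ m) :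
    Dmat (m + 1) *ᵥ expProfile m =
      (4 / 3 : ℝ) • expProfile m - (2 * 3 ^ m + 2 / 3 : ℝ) • psi (m + 1) := by
  ext i
  have h := Dmat_mulVec hm (fun i => (3 : ℝ) ^ (m - i) - 3 ^ i) i
  refine h.trans ?_
  obtain ⟨i, hi⟩ := i
  obtain ⟨k, rfl⟩ := Nat.exists_eq_add_of_le (Nat.lt_succ_iff.mp hi)
  simp only [expProfile, psi, Pi.sub_apply, Pi.smul_apply, smul_eq_mul, Nat.add_sub_cancel,
    Nat.add_sub_cancel_left]
  rcases i with _ | i <;> rcases k with _ | k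
  · omega
  · simp [pow_succ]
    ring
  · simp [pow_succ]
    ring
  · have e1 : i + 1 + (k + 1) - i = k + 2 := by omega
    have e2 : i + 1 + (k + 1) - (i + 1 + 1) = k := by omega
    simp [pow_succ, e1, e2]
    ring

open Matrix in
lemma expProfile_dotProduct_psi {m : ℕ} (hm : 1 ≤ m) :
    expProfile m ⬝ᵥ psi (m + 1) = 2 * (3 ^ m - 1) := by
  rw [dotProduct_psi hm]
  simp [expProfile]
  ring

open Matrix in
lemma le_expProfile_dotProduct_self {m : ℕ} (hm : 1 ≤ m) :
    2 * (3 ^ m - 1 : ℝ) ^ 2 ≤ expProfile m ⬝ᵥ expProfile m := by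
  have hne : (0 : Fin (m + 1)) ≠ Fin.last m := by
    rw [Ne, Fin.ext_iff]
    simp
    omega
  have h := Finset.sum_le_sum_of_subset_of_nonneg
    (Finset.subset_univ ({0, Fin.last m} : Finset (Fin (m + 1))))
    (fun i _ _ => mul_self_nonneg (expProfile m i))
  rw [Finset.sum_pair hne] at h
  refine le_trans (le_of_eq ?_) h
  simp [expProfile]
  ring

open Matrix in
lemma add_vecMulVec_self_mulVec {ι : Type*} [Fintype ι] (A : Matrix ι ι ℝ) (p x : ι → ℝ) :
    (A + vecMulVec p p) *ᵥ x = A *ᵥ x + (x ⬝ᵥ p) • p := by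
  rw [add_mulVec, vecMulVec_mulVec, dotProduct_comm]
  ext i
  simp [mul_comm]

open Matrix in
lemma dotProduct_add_vecMulVec_self_mulVec {ι : Type*} [Fintype ι] (A : Matrix ι ι ℝ)
    (p x : ι → ℝ) :
    x ⬝ᵥ (A + vecMulVec p p) *ᵥ x = x ⬝ᵥ A *ᵥ x + (x ⬝ᵥ p) ^ 2 := by
  rw [add_vecMulVec_self_mulVec, dotProduct_add, dotProduct_smul, smul_eq_mul, sq]

open Matrix in
/-- The upper bound: the form of `D + ψψᵀ` is at most `4/3` times the squared norm. -/
lemma dotProduct_mulVec_le {m : ℕ} (hm : 1 ≤ m) (x : Fin (m + 1) → ℝ) :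
    x ⬝ᵥ (Dmat (m + 1) + vecMulVec (psi (m + 1)) (psi (m + 1))) *ᵥ x ≤ 4 / 3 * (x ⬝ᵥ x) := by
  have hN : (1 : ℝ) ≤ 3 ^ m := one_le_pow₀ (by norm_num)
  set N : ℝ := 3 ^ m with hNdef
  set w := expProfile m
  set p := psi (m + 1)
  set D := Dmat (m + 1)
  have hDw : D *ᵥ w = (4 / 3 : ℝ) • w - (2 * N + 2 / 3 : ℝ) • p := Dmat_mulVec_expProfile hm
  have hwp : w ⬝ᵥ p = 2 * (N - 1) := expProfile_dotProduct_psi hm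
  rw [dotProduct_add_vecMulVec_self_mulVec]
  set s := x ⬝ᵥ p with hs
  set t := s / (2 * N + 2 / 3) with ht
  have hts : t * (2 * N + 2 / 3) = s := div_mul_cancel₀ _ (by positivity)
  have hneg := dotProduct_Dmat_mulVec_nonpos hm (x - t • w)
  have hsq : 0 ≤ (x - t • w) ⬝ᵥ (x - t • w) := by
    simpa using dotProduct_star_self_nonneg (x - t • w)
  have hsymm : w ⬝ᵥ D *ᵥ x = x ⬝ᵥ D *ᵥ w := by
    rw [dotProduct_mulVec, ← mulVec_transpose, (Dmat_isSymm _).eq, dotProduct_comm]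
  have hxDw : x ⬝ᵥ D *ᵥ w = 4 / 3 * (x ⬝ᵥ w) - (2 * N + 2 / 3) * s := by
    rw [hDw, dotProduct_sub, dotProduct_smul, dotProduct_smul, smul_eq_mul, smul_eq_mul]
  have hwDw : w ⬝ᵥ D *ᵥ w = 4 / 3 * (w ⬝ᵥ w) - (2 * N + 2 / 3) * (2 * (N - 1)) := by
    rw [hDw, dotProduct_sub, dotProduct_smul, dotProduct_smul, smul_eq_mul, smul_eq_mul, hwp]
  change (x - t • w) ⬝ᵥ D *ᵥ (x - t • w) ≤ 0 at hneg
  simp only [mulVec_sub, mulVec_smul, sub_dotProduct, dotProduct_sub, smul_dotProduct,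
    dotProduct_smul, smul_eq_mul, hsymm, hxDw, hwDw, dotProduct_comm w x] at hneg hsq
  have hgap : 2 * (N - 1) * t ^ 2 * (2 * N + 2 / 3) ≤ s ^ 2 := by
    rw [← hts]
    have : 0 ≤ t ^ 2 * (2 * N + 2 / 3) := by positivity
    nlinarith
  rw [← hts] at hneg hgap ⊢
  nlinarith

open Matrix in
/-- The test vector bound: the Rayleigh quotient at `expProfile` is nearly `4/3`. -/
lemma le_expProfile_dotProduct_mulVec {m : ℕ} (hm : 1 ≤ m) :
    (4 / 3 - 9 / 3 ^ m) * (expProfile m ⬝ᵥ expProfile m) ≤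
      expProfile m ⬝ᵥ
        (Dmat (m + 1) + vecMulVec (psi (m + 1)) (psi (m + 1))) *ᵥ expProfile m := by
  have hN : (3 : ℝ) ≤ 3 ^ m := le_self_pow₀ (by norm_num) (by omega)
  rw [dotProduct_add_vecMulVec_self_mulVec, Dmat_mulVec_expProfile hm, dotProduct_sub,
    dotProduct_smul, dotProduct_smul, smul_eq_mul, smul_eq_mul, expProfile_dotProduct_psi hm]
  have hnorm := le_expProfile_dotProduct_self hm
  set N : ℝ := 3 ^ m
  set q := expProfile m ⬝ᵥ expProfile m
  have h1 : 16 / 3 * (N - 1) ≤ 9 / N * q := by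
    rw [show 9 / N * q = 9 * q / N by ring, le_div_iff₀ (by linarith)]
    nlinarith [mul_nonneg (show 0 ≤ N - 1 by linarith) (show 0 ≤ N - 3 by linarith)]
  nlinarith

open Matrix in
/-- A rank-one perturbation of a negative semidefinite matrix has at most one positive
eigenvalue. -/
lemma eq_of_eigenvalue_pos {ι : Type*} [Fintype ι] [DecidableEq ι] {A : Matrix ι ι ℝ}
    (hA : ∀ x, x ⬝ᵥ A *ᵥ x ≤ 0) (p : ι → ℝ) {μ : ι → ℝ} {u : ι → ι → ℝ}
    (hu : ∀ k, (A + vecMulVec p p) *ᵥ u k = μ k • u k)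
    (hortho : ∀ k l, u k ⬝ᵥ u l = if k = l then 1 else 0)
    {k l : ι} (hk : 0 < μ k) (hl : 0 < μ l) : k = l := by
  by_contra hkl
  have hb : u k ⬝ᵥ p ≠ 0 := fun h0 => by
    have h := dotProduct_add_vecMulVec_self_mulVec A p (u k)
    rw [hu, dotProduct_smul, hortho, if_pos rfl, h0, smul_eq_mul] at h
    have := hA (u k)
    linarith
  set a := u l ⬝ᵥ p
  set b := u k ⬝ᵥ p
  have h := dotProduct_add_vecMulVec_self_mulVec A p (a • u k - b • u l)
  have hneg := hA (a • u k - b • u l)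
  have hperp : (a • u k - b • u l) ⬝ᵥ p = 0 := by
    rw [sub_dotProduct, smul_dotProduct, smul_dotProduct, smul_eq_mul, smul_eq_mul]
    exact sub_eq_zero.mpr (mul_comm a b)
  rw [hperp, mulVec_sub, mulVec_smul, mulVec_smul, hu, hu] at h
  simp only [sub_dotProduct, dotProduct_sub, smul_dotProduct, dotProduct_smul, smul_eq_mul,
    hortho, if_neg hkl, if_neg (Ne.symm hkl), if_true] at h
  simp only [sub_dotProduct, smul_dotProduct, smul_eq_mul] at hneg
  have h1 : 0 < b ^ 2 * μ l := by positivity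
  have h2 : 0 ≤ a ^ 2 * μ k := by positivity
  nlinarith

/-- For `n ≥ 5`, the matrix `M = D + ψψᵀ` has exactly one strictly positive
eigenvalue `μ` counted with multiplicity, and `4/3 − 3^{−(n−3)} ≤ μ ≤ 4/3`. -/
theorem unique_positive_eigenvalue_bounds (n : ℕ) (hn : 5 ≤ n) :
    ∃ μ : Fin n → ℝ,
      (Dmat n + Matrix.vecMulVec (psi n) (psi n)).charpoly =
        ∏ k : Fin n, (Polynomial.X - Polynomial.C (μ k)) ∧
      (Finset.univ.filter fun k => 0 < μ k).card = 1 ∧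
      ∀ k, 0 < μ k → 4 / 3 - ((3 : ℝ) ^ (n - 3))⁻¹ ≤ μ k ∧ μ k ≤ 4 / 3 := by
  obtain ⟨m, rfl⟩ : ∃ m, n = m + 1 := ⟨n - 1, by omega⟩
  have hm : 1 ≤ m := by omega
  have hsymm : (Dmat (m + 1) + Matrix.vecMulVec (psi (m + 1)) (psi (m + 1))).IsSymm :=
    (Dmat_isSymm _).add (Matrix.transpose_vecMulVec _ _)
  obtain ⟨μ, u, hchar, hu, hortho, hsum⟩ := hsymm.exists_eigenpairs
  have hscale : (9 : ℝ) / 3 ^ m = (3 ^ (m + 1 - 3))⁻¹ := by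
    obtain ⟨j, rfl⟩ : ∃ j, m = j + 2 := ⟨m - 2, by omega⟩
    rw [show j + 2 + 1 - 3 = j by omega, pow_add]
    field_simp
    norm_num
  have hN : (81 : ℝ) ≤ 3 ^ m := by
    calc (81 : ℝ) = 3 ^ 4 := by norm_num
      _ ≤ 3 ^ m := pow_le_pow_right₀ (by norm_num) (by omega)
  have hw : 0 < expProfile m ⬝ᵥ expProfile m :=
    lt_of_lt_of_le (by nlinarith) (le_expProfile_dotProduct_self hm)
  obtain ⟨k₀, hk₀⟩ := exists_le_eigenvalue hsymm hu hsum hw (le_expProfile_dotProduct_mulVec hm)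
  have hpos : 0 < μ k₀ := by
    refine lt_of_lt_of_le (sub_pos.mpr ?_) hk₀
    rw [div_lt_iff₀ (by positivity)]
    linarith
  have huniq : ∀ k, 0 < μ k → k = k₀ := fun k hk =>
    eq_of_eigenvalue_pos (dotProduct_Dmat_mulVec_nonpos hm) _ hu hortho hk hpos
  refine ⟨μ, hchar, Finset.card_eq_one.mpr ⟨k₀, ?_⟩, fun k hk => ⟨?_, ?_⟩⟩
  · ext k
    simp only [Finset.mem_filter, Finset.mem_univ, true_and, Finset.mem_singleton]
    exact ⟨huniq k, fun h => h ▸ hpos⟩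
  · rw [huniq k hk, ← hscale]
    exact hk₀
  · have h := dotProduct_mulVec_le hm (u k)
    rw [hu, dotProduct_smul, hortho, if_pos rfl, smul_eq_mul] at h
    linarith
end
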